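/- Let d ≥ 2, 0 < θ ≤ ∞ and r > (1 − 1/θ)_+. Then there exist constants c, C > 0 and m₀ ∈ ℕ such that for all m ≥ m₀: c · m^{−(r + 1/θ − 1/2)} (log* m)^{(d−1)r} ≤ σ_m(S^r_θ A)_{L_∞} ≤ C · m^{−(r + 1/θ − 1/2)} (log* m)^{(d−1)r + 1/2}. -/

import Mathlib

open MeasureTheory Real ENNReal

noncomputable section

namespace Paper

/-- The fundamental domain `[0,1)^d` of the `d`-dimensional torus `𝕋^d`. -/
def cube (d : ℕ) : Set (Fin d → ℝ) := Set.univ.pi fun _ => Set.Ico (0:ℝ) 1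

/-- The trigonometric character `x ↦ e^{2π i k·x}`. -/
def expk (d : ℕ) (k : Fin d → ℤ) (x : Fin d → ℝ) : ℂ :=
  Complex.exp (((2 * Real.pi * ∑ i, (k i : ℝ) * x i : ℝ) : ℂ) * Complex.I)

/-- Fourier coefficient `f̂(k) = ∫_{[0,1)^d} f(x) e^{-2π i k·x} dx`. -/
def fCoeff (d : ℕ) (f : (Fin d → ℝ) → ℂ) (k : Fin d → ℤ) : ℂ :=
  ∫ x in cube d, f x * expk d (-k) x

/-- The `L_q` (quasi-)norm on the torus, `q ∈ (0,∞]`, valued in `ℝ≥0∞`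
(for `q = ∞` this is the essential supremum). -/
def LqNorm (d : ℕ) (q : ℝ≥0∞) (f : (Fin d → ℝ) → ℂ) : ℝ≥0∞ :=
  eLpNorm f q (volume.restrict (cube d))

/-- The weight `∏_{i=1}^d (1+|k_i|)`. -/
def wt (d : ℕ) (k : Fin d → ℤ) : ℝ := ∏ i, (1 + |(k i : ℝ)|)

/-- The weighted Wiener (quasi-)norm `‖f‖_{S^r_θ A}`
(with the sup modification for `θ = ∞`); `A_θ` corresponds to `r = 0`,
the Wiener algebra `A` to `r = 0`, `θ = 1`. -/
def wienerNorm (d : ℕ) (r : ℝ) (θ : ℝ≥0∞) (f : (Fin d → ℝ) → ℂ) : ℝ≥0∞ :=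
  if θ = ∞ then ⨆ k : Fin d → ℤ, ENNReal.ofReal (wt d k ^ r) * (‖fCoeff d f k‖₊ : ℝ≥0∞)
  else (∑' k : Fin d → ℤ,
      (ENNReal.ofReal (wt d k ^ r) * (‖fCoeff d f k‖₊ : ℝ≥0∞)) ^ θ.toReal) ^ (1 / θ.toReal)

/-- Trigonometric polynomials with at most `m` terms. -/
def trigPoly (d m : ℕ) : Set ((Fin d → ℝ) → ℂ) :=
  {s | ∃ (Λ : Finset (Fin d → ℤ)) (a : (Fin d → ℤ) → ℂ),
    Λ.card ≤ m ∧ s = fun x => ∑ k ∈ Λ, a k * expk d k x}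

/-- Best `m`-term trigonometric approximation error of `f`, error measured by `X`. -/
def sigmaF (d m : ℕ) (X : ((Fin d → ℝ) → ℂ) → ℝ≥0∞) (f : (Fin d → ℝ) → ℂ) : ℝ≥0∞ :=
  ⨅ s ∈ trigPoly d m, X (f - s)

/-- The unit ball of the space (inside `L₁(𝕋^d)`) with (quasi-)norm `N`. -/
def unitBall (d : ℕ) (N : ((Fin d → ℝ) → ℂ) → ℝ≥0∞) : Set ((Fin d → ℝ) → ℂ) :=
  {f | IntegrableOn f (cube d) ∧ N f ≤ 1}

/-- Best `m`-term trigonometric width of the unit ball of `N`, error measured by `X`. -/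
def sigmaClass (d m : ℕ) (N X : ((Fin d → ℝ) → ℂ) → ℝ≥0∞) : ℝ≥0∞ :=
  ⨆ f ∈ unitBall d N, sigmaF d m X f

/-- `log*(m) = max (log₂ m) 1`. -/
def logStar (m : ℕ) : ℝ := max (Real.logb 2 m) 1

/-- Two-sided asymptotic equivalence `a_m ≍ b_m`. -/
def IsAsympEquiv (a : ℕ → ℝ≥0∞) (b : ℕ → ℝ) : Prop :=
  ∃ c C : ℝ, 0 < c ∧ 0 < C ∧ ∃ m₀ : ℕ, ∀ m : ℕ, m₀ ≤ m →
    ENNReal.ofReal (c * b m) ≤ a m ∧ a m ≤ ENNReal.ofReal (C * b m)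

/-- One-sided asymptotic bound `a_m ≲ b_m`. -/
def IsAsympLe (a : ℕ → ℝ≥0∞) (b : ℕ → ℝ) : Prop :=
  ∃ C : ℝ, 0 < C ∧ ∃ m₀ : ℕ, ∀ m : ℕ, m₀ ≤ m → a m ≤ ENNReal.ofReal (C * b m)

/-- Dyadic block `I_0 = {0}`, `I_n = {k : 2^{n-1} ≤ |k| < 2^n}` for `n ≥ 1`. -/
def blockF (n : ℕ) : Finset ℤ :=
  (Finset.Icc (-(2^n : ℤ)) (2^n)).filter fun k =>
    (n = 0 ∧ k = 0) ∨ (n ≠ 0 ∧ 2^(n-1) ≤ |k| ∧ |k| < 2^n)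

/-- The dyadic block projection `∑_{k ∈ I_j} f̂(k) e^{2π i k·x}`. -/
def blockProj (d : ℕ) (f : (Fin d → ℝ) → ℂ) (j : Fin d → ℕ) : (Fin d → ℝ) → ℂ :=
  fun x => ∑ k ∈ Fintype.piFinset (fun i => blockF (j i)), fCoeff d f k * expk d k x

/-- The mixed-smoothness Besov (quasi-)norm `‖f‖_{S^s_{p,θ}B}`
(with the sup modification for `θ = ∞`). -/
def besovNorm (d : ℕ) (s : ℝ) (p θ : ℝ≥0∞) (f : (Fin d → ℝ) → ℂ) : ℝ≥0∞ :=
  if θ = ∞ then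
    ⨆ j : Fin d → ℕ,
      ENNReal.ofReal ((2:ℝ) ^ (((∑ i, j i : ℕ) : ℝ) * s)) * LqNorm d p (blockProj d f j)
  else
    (∑' j : Fin d → ℕ,
      (ENNReal.ofReal ((2:ℝ) ^ (((∑ i, j i : ℕ) : ℝ) * s)) * LqNorm d p (blockProj d f j))
        ^ θ.toReal) ^ (1 / θ.toReal)

/-- The mixed-smoothness Sobolev norm `‖f‖_{S^s_p W}` (Littlewood–Paley form),
with `S^0_p W := L_p`. -/
def sobolevNorm (d : ℕ) (s : ℝ) (p : ℝ≥0∞) (f : (Fin d → ℝ) → ℂ) : ℝ≥0∞ :=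
  if s = 0 then LqNorm d p f
  else
    (∫⁻ x in cube d,
      ((∑' j : Fin d → ℕ,
        (ENNReal.ofReal ((2:ℝ) ^ (((∑ i, j i : ℕ) : ℝ) * s)) *
          (‖blockProj d f j x‖₊ : ℝ≥0∞)) ^ (2:ℕ)) ^ ((1:ℝ)/2)) ^ p.toReal) ^ (1 / p.toReal)

/-- Trigonometric polynomials with frequencies in `[-M,M]^d`. -/
def boxPoly (d M : ℕ) : Set ((Fin d → ℝ) → ℂ) :=
  {s | ∃ (Λ : Finset (Fin d → ℤ)) (a : (Fin d → ℤ) → ℂ),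
    (∀ k ∈ Λ, ∀ i, |k i| ≤ (M : ℤ)) ∧ s = fun x => ∑ k ∈ Λ, a k * expk d k x}

/-- Error of best approximation by trigonometric polynomials with
frequencies in `[-M,M]^d`, measured in `L_∞`. -/
def EBox (d M : ℕ) (f : (Fin d → ℝ) → ℂ) : ℝ≥0∞ :=
  ⨅ g ∈ boxPoly d M, LqNorm d ∞ (f - g)

/-- The `m`-th (non-linear) sampling width of the class of continuous functions
in the unit ball of `N`, error measured in `L_q`. -/
def samplingWidth (d m : ℕ) (N : ((Fin d → ℝ) → ℂ) → ℝ≥0∞) (q : ℝ≥0∞) : ℝ≥0∞ :=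
  ⨅ (t : Fin m → (Fin d → ℝ)) (_ : ∀ i, t i ∈ cube d)
    (R : (Fin m → ℂ) → ((Fin d → ℝ) → ℂ)),
    ⨆ f ∈ {f : (Fin d → ℝ) → ℂ | Continuous f ∧ N f ≤ 1},
      LqNorm d q (f - R fun i => f (t i))


/-- The hyperbolic cross `{k : ∏ (1+|k_i|) ≤ W}` as a finite set. -/
def cross (d : ℕ) (W : ℝ) : Finset (Fin d → ℤ) :=
  (Fintype.piFinset fun _ => Finset.Icc (-⌈W⌉) ⌈W⌉).filter fun k => wt d k ≤ W

lemma one_le_wt (d : ℕ) (k : Fin d → ℤ) : 1 ≤ wt d k :=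
  Finset.one_le_prod fun i => by simp

lemma wt_pos (d : ℕ) (k : Fin d → ℤ) : 0 < wt d k := zero_lt_one.trans_le (one_le_wt d k)

lemma one_add_abs_le_wt (d : ℕ) (k : Fin d → ℤ) (i : Fin d) : 1 + |(k i : ℝ)| ≤ wt d k := by
  rw [wt, ← Finset.mul_prod_erase _ _ (Finset.mem_univ i)]
  exact le_mul_of_one_le_right (by positivity) (Finset.one_le_prod fun j => by simp)

lemma mem_cross {d : ℕ} {W : ℝ} {k : Fin d → ℤ} : k ∈ cross d W ↔ wt d k ≤ W := by
  simp only [cross, Finset.mem_filter, Fintype.mem_piFinset, Finset.mem_Icc, and_iff_right_iff_imp]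
  intro h i
  have h1 : |(k i : ℝ)| ≤ W := by linarith [one_add_abs_le_wt d k i]
  have h2 : |(k i : ℝ)| ≤ (⌈W⌉ : ℝ) := h1.trans (Int.le_ceil W)
  exact abs_le.mp (by exact_mod_cast h2)

lemma wt_cons (d : ℕ) (j : ℤ) (k : Fin d → ℤ) :
    wt (d + 1) (Fin.cons j k : Fin (d + 1) → ℤ) = (1 + |(j : ℝ)|) * wt d k := by
  simp [wt, Fin.prod_univ_succ]

lemma card_cross_zero {W : ℝ} (hW : 1 ≤ W) : (cross 0 W).card = 1 := by
  rw [Finset.card_eq_one]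
  refine ⟨0, ?_⟩
  ext k
  rw [mem_cross, Finset.mem_singleton]
  simp [wt, hW, Subsingleton.elim k 0]

lemma card_cross_succ_le (d : ℕ) (W : ℝ) :
    (cross (d + 1) W).card ≤ ∑ i ∈ Finset.range ⌊W⌋₊, 2 * (cross d (W / (1 + i))).card := by
  classical
  have hsub : cross (d + 1) W ⊆ (Finset.range ⌊W⌋₊).biUnion fun i : ℕ =>
      ((cross d (W / (1 + i))).image fun k => (Fin.cons (i : ℤ) k : Fin (d + 1) → ℤ)) ∪
      ((cross d (W / (1 + i))).image fun k => (Fin.cons (-(i : ℤ)) k : Fin (d + 1) → ℤ)) := by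
    intro k hk
    rw [mem_cross] at hk
    obtain ⟨j, k', rfl⟩ : ∃ j k', k = (Fin.cons j k' : Fin (d + 1) → ℤ) :=
      ⟨k 0, Fin.tail k, (Fin.cons_self_tail k).symm⟩
    rw [wt_cons] at hk
    have hj : |(j : ℝ)| = (j.natAbs : ℝ) := by simp
    rw [hj] at hk
    have hmem : k' ∈ cross d (W / (1 + (j.natAbs : ℝ))) := by
      rw [mem_cross, le_div_iff₀ (by positivity)]
      linarith
    have hlt : j.natAbs < ⌊W⌋₊ := by
      rw [← Nat.succ_le_iff]
      apply Nat.le_floor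
      push_cast
      have := one_le_wt d k'
      nlinarith [(Nat.cast_nonneg j.natAbs : (0 : ℝ) ≤ _)]
    simp only [Finset.mem_biUnion, Finset.mem_range, Finset.mem_union, Finset.mem_image]
    refine ⟨j.natAbs, hlt, ?_⟩
    rcases Int.natAbs_eq j with h | h
    · exact Or.inl ⟨k', hmem, by rw [← h]⟩
    · exact Or.inr ⟨k', hmem, by rw [← h]⟩
  refine (Finset.card_le_card hsub).trans (Finset.card_biUnion_le.trans ?_)
  refine Finset.sum_le_sum fun i _ => ?_
  refine (Finset.card_union_le _ _).trans ?_
  rw [two_mul]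
  exact add_le_add Finset.card_image_le Finset.card_image_le

lemma sum_card_cross_le (d n : ℕ) (W : ℝ) :
    ∑ i ∈ Finset.range n, (cross d (W / (1 + i))).card ≤ (cross (d + 1) W).card := by
  classical
  have hinj : ∀ i : ℕ, Function.Injective fun k : Fin d → ℤ =>
      (Fin.cons (i : ℤ) k : Fin (d + 1) → ℤ) := fun i => Fin.cons_right_injective (α := fun _ => ℤ) (i : ℤ)
  calc ∑ i ∈ Finset.range n, (cross d (W / (1 + i))).card
      = ((Finset.range n).biUnion fun i : ℕ => (cross d (W / (1 + i))).image
          fun k => (Fin.cons (i : ℤ) k : Fin (d + 1) → ℤ)).card := by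
        rw [Finset.card_biUnion]
        · exact Finset.sum_congr rfl fun i _ => (Finset.card_image_of_injective _ (hinj i)).symm
        · intro i _ j _ hij
          rw [Function.onFun, Finset.disjoint_left]
          intro k hk hk'
          obtain ⟨a, -, rfl⟩ := Finset.mem_image.mp hk
          obtain ⟨b, -, hb⟩ := Finset.mem_image.mp hk'
          have := congrFun hb 0
          simp only [Fin.cons_zero] at this
          exact hij (by exact_mod_cast this.symm)
    _ ≤ _ := by
        refine Finset.card_le_card fun k hk => ?_
        obtain ⟨i, -, hk⟩ := Finset.mem_biUnion.mp hk
        obtain ⟨a, ha, rfl⟩ := Finset.mem_image.mp hk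
        rw [mem_cross, le_div_iff₀ (by positivity)] at ha
        rw [mem_cross, wt_cons]
        simp only [Int.cast_natCast, Nat.abs_cast]
        linarith

lemma sum_inv_le {W : ℝ} (hW : 1 ≤ W) :
    ∑ i ∈ Finset.range ⌊W⌋₊, (1 + (i : ℝ))⁻¹ ≤ 1 + Real.log W := by
  have := harmonic_floor_le_one_add_log W hW
  simpa [harmonic, add_comm] using this

lemma log_le_sum_inv {W : ℝ} (hW : 0 ≤ W) :
    Real.log W ≤ ∑ i ∈ Finset.range ⌊W⌋₊, (1 + (i : ℝ))⁻¹ := by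
  have := log_le_harmonic_floor W hW
  simpa [harmonic, add_comm] using this

lemma card_cross_le (d : ℕ) : ∀ W : ℝ, 1 ≤ W →
    ((cross (d + 1) W).card : ℝ) ≤ 2 ^ (d + 1) * W * (1 + Real.log W) ^ d := by
  have key : ∀ (d : ℕ) (W : ℝ), ((cross (d + 1) W).card : ℝ) ≤
      ∑ i ∈ Finset.range ⌊W⌋₊, 2 * ((cross d (W / (1 + i))).card : ℝ) := fun d W => by
    exact_mod_cast card_cross_succ_le d W
  have hquot : ∀ {W : ℝ}, 1 ≤ W → ∀ i ∈ Finset.range ⌊W⌋₊, 1 ≤ W / (1 + (i : ℝ)) := by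
    intro W hW i hi
    rw [le_div_iff₀ (by positivity), one_mul]
    have h1 : i + 1 ≤ ⌊W⌋₊ := Finset.mem_range.mp hi
    have h2 : ((i + 1 : ℕ) : ℝ) ≤ W := (Nat.le_floor_iff (by linarith)).mp h1
    push_cast at h2
    linarith
  induction d with
  | zero =>
    intro W hW
    refine (key 0 W).trans ?_
    rw [Finset.sum_congr rfl fun i hi => by rw [card_cross_zero (hquot hW i hi)]]
    have := Nat.floor_le (show 0 ≤ W by linarith)
    simp
    linarith
  | succ d ih =>
    intro W hW
    have hlog := Real.log_nonneg hW
    refine (key (d + 1) W).trans ?_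
    calc ∑ i ∈ Finset.range ⌊W⌋₊, 2 * ((cross (d + 1) (W / (1 + i))).card : ℝ)
        ≤ ∑ i ∈ Finset.range ⌊W⌋₊,
            2 ^ (d + 2) * W * (1 + Real.log W) ^ d * (1 + (i : ℝ))⁻¹ := by
          refine Finset.sum_le_sum fun i hi => ?_
          have h1 := ih _ (hquot hW i hi)
          have h3 : Real.log (W / (1 + (i : ℝ))) ≤ Real.log W := by
            apply Real.log_le_log (by linarith [hquot hW i hi])
            exact div_le_self (by linarith) (by simp)
          have h4 : (1 + Real.log (W / (1 + (i : ℝ)))) ^ d ≤ (1 + Real.log W) ^ d :=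
            pow_le_pow_left₀ (by linarith [Real.log_nonneg (hquot hW i hi)]) (by linarith) d
          calc 2 * ((cross (d + 1) (W / (1 + i))).card : ℝ)
              ≤ 2 * (2 ^ (d + 1) * (W / (1 + i)) * (1 + Real.log W) ^ d) := by
                have : (0 : ℝ) ≤ 2 ^ (d + 1) * (W / (1 + i)) := by positivity
                nlinarith [mul_le_mul_of_nonneg_left h4 this]
            _ = _ := by rw [div_eq_mul_inv]; ring
      _ ≤ 2 ^ (d + 2) * W * (1 + Real.log W) ^ d * (1 + Real.log W) := by
          rw [← Finset.mul_sum]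
          exact mul_le_mul_of_nonneg_left (sum_inv_le hW) (by positivity)
      _ = _ := by ring

lemma le_card_cross (d : ℕ) : ∃ c : ℝ, 0 < c ∧ ∀ W : ℝ, 1 ≤ W →
    c * W * Real.log W ^ d ≤ ((cross (d + 1) W).card : ℝ) := by
  have key : ∀ (d n : ℕ) (W : ℝ), ∑ i ∈ Finset.range n, ((cross d (W / (1 + i))).card : ℝ) ≤
      ((cross (d + 1) W).card : ℝ) := fun d n W => by
    exact_mod_cast sum_card_cross_le d n W
  induction d with
  | zero =>
    refine ⟨1 / 2, by norm_num, fun W hW => ?_⟩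
    refine le_trans ?_ (key 0 ⌊W⌋₊ W)
    have hquot : ∀ i ∈ Finset.range ⌊W⌋₊, 1 ≤ W / (1 + (i : ℝ)) := by
      intro i hi
      rw [le_div_iff₀ (by positivity), one_mul]
      have h1 : i + 1 ≤ ⌊W⌋₊ := Finset.mem_range.mp hi
      have h2 : ((i + 1 : ℕ) : ℝ) ≤ W := (Nat.le_floor_iff (by linarith)).mp h1
      push_cast at h2
      linarith
    rw [Finset.sum_congr rfl fun i hi => by rw [card_cross_zero (hquot i hi)]]
    have h1 := Nat.lt_floor_add_one W
    have h2 : (1 : ℝ) ≤ ⌊W⌋₊ := by exact_mod_cast (Nat.one_le_floor_iff W).mpr hW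
    simp
    linarith
  | succ d ih =>
    obtain ⟨c, hc, ih⟩ := ih
    refine ⟨c / 2 ^ (d + 1), by positivity, fun W hW => ?_⟩
    have hlog := Real.log_nonneg hW
    refine le_trans ?_ (key (d + 1) ⌊√W⌋₊ W)
    have hs1 : 1 ≤ √W := Real.one_le_sqrt.mpr hW
    have hls : Real.log √W = Real.log W / 2 := Real.log_sqrt (by linarith)
    calc c / 2 ^ (d + 1) * W * Real.log W ^ (d + 1)
        = c * W * (Real.log √W) ^ d * Real.log √W := by
          rw [hls, div_pow]; field_simp; ring
      _ ≤ c * W * (Real.log √W) ^ d * ∑ i ∈ Finset.range ⌊√W⌋₊, (1 + (i : ℝ))⁻¹ :=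
          mul_le_mul_of_nonneg_left (log_le_sum_inv (Real.sqrt_nonneg W))
            (by rw [hls]; positivity)
      _ ≤ _ := by
          rw [Finset.mul_sum]
          refine Finset.sum_le_sum fun i hi => ?_
          have h1 : i + 1 ≤ ⌊√W⌋₊ := Finset.mem_range.mp hi
          have h2 : ((i + 1 : ℕ) : ℝ) ≤ √W := (Nat.le_floor_iff (by linarith)).mp h1
          push_cast at h2
          have h3 : √W ≤ W / (1 + (i : ℝ)) := by
            rw [le_div_iff₀ (by positivity)]
            nlinarith [Real.mul_self_sqrt (show 0 ≤ W by linarith)]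
          have h4 := ih _ (hs1.trans h3)
          refine le_trans ?_ h4
          have h5 : Real.log √W ≤ Real.log (W / (1 + (i : ℝ))) :=
            Real.log_le_log (by linarith) h3
          calc c * W * Real.log √W ^ d * (1 + (i : ℝ))⁻¹
              = c * (W / (1 + i)) * Real.log √W ^ d := by rw [div_eq_mul_inv]; ring
            _ ≤ _ := by
              refine mul_le_mul_of_nonneg_left (pow_le_pow_left₀ (by rw [hls]; positivity) h5 d) ?_
              positivity

lemma tsum_wt_rpow_neg_le (d : ℕ) {s : ℝ} (hs : 1 < s) : ∃ C : ℝ, 0 < C ∧ ∀ W : ℝ, 1 ≤ W →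
    ∑' k : Fin (d + 1) → ℤ, (if W < wt (d + 1) k then ENNReal.ofReal (wt (d + 1) k ^ (-s)) else 0)
      ≤ ENNReal.ofReal (C * (W ^ (1 - s) * (1 + Real.log W) ^ d)) := by
  set q : ℝ := 2 ^ (1 - s) with hq
  have hq0 : 0 < q := by positivity
  have hq1 : q < 1 := Real.rpow_lt_one_of_one_lt_of_neg (by norm_num) (by linarith)
  have hsum : Summable fun ν : ℕ => ((ν : ℝ) + 2) ^ d * q ^ ν := by
    have h1 := summable_pow_mul_geometric_of_norm_lt_one (R := ℝ) d
      (r := q) (by rwa [Real.norm_of_nonneg hq0.le])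
    have h2 := ((summable_nat_add_iff 2).mpr h1).mul_right (q ^ 2)⁻¹
    refine h2.congr fun ν => ?_
    push_cast
    field_simp
    ring
  set S : ℝ := ∑' ν : ℕ, ((ν : ℝ) + 2) ^ d * q ^ ν with hS
  have hSpos : 0 < S := hsum.tsum_pos (fun ν => by positivity) 0 (by positivity)
  refine ⟨2 ^ (d + 2) * S, by positivity, fun W hW => ?_⟩
  have hW0 : 0 < W := by linarith
  have hlog := Real.log_nonneg hW
  calc ∑' k : Fin (d + 1) → ℤ,
        (if W < wt (d + 1) k then ENNReal.ofReal (wt (d + 1) k ^ (-s)) else 0)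
      ≤ ∑' k : Fin (d + 1) → ℤ, ∑' ν : ℕ,
        (if k ∈ cross (d + 1) (2 ^ (ν + 1) * W) then ENNReal.ofReal ((2 ^ ν * W) ^ (-s)) else 0) := by
        refine ENNReal.tsum_le_tsum fun k => ?_
        split_ifs with hk
        · obtain ⟨ν, h1, h2⟩ := exists_nat_pow_near (x := wt (d + 1) k / W)
            ((one_le_div hW0).mpr hk.le) (y := 2) (by norm_num)
          refine le_trans ?_ (ENNReal.le_tsum ν)
          rw [if_pos (mem_cross.mpr ((div_le_iff₀ hW0).mp h2.le))]
          refine ENNReal.ofReal_le_ofReal ?_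
          exact Real.rpow_le_rpow_of_nonpos (by positivity) ((le_div_iff₀ hW0).mp h1) (by linarith)
        · exact zero_le
    _ = ∑' ν : ℕ, ∑' k : Fin (d + 1) → ℤ,
        (if k ∈ cross (d + 1) (2 ^ (ν + 1) * W) then ENNReal.ofReal ((2 ^ ν * W) ^ (-s)) else 0) :=
        ENNReal.tsum_comm
    _ ≤ ∑' ν : ℕ, ENNReal.ofReal
          (2 ^ (d + 2) * (W ^ (1 - s) * (1 + Real.log W) ^ d) * (((ν : ℝ) + 2) ^ d * q ^ ν)) := by
        refine ENNReal.tsum_le_tsum fun ν => ?_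
        rw [tsum_eq_sum (s := cross (d + 1) (2 ^ (ν + 1) * W)) (fun k hk => if_neg hk),
          Finset.sum_congr rfl fun k hk => if_pos hk, Finset.sum_const, nsmul_eq_mul,
          ← ENNReal.ofReal_natCast, ← ENNReal.ofReal_mul (Nat.cast_nonneg _)]
        refine ENNReal.ofReal_le_ofReal ?_
        have h2 : (1 : ℝ) ≤ 2 ^ (ν + 1) := one_le_pow₀ (by norm_num)
        have h3 : 1 ≤ 2 ^ (ν + 1) * W := one_le_mul_of_one_le_of_one_le h2 hW
        have h4 : Real.log (2 ^ (ν + 1) * W) ≤ (ν + 1) + Real.log W := by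
          rw [Real.log_mul (by positivity) hW0.ne', Real.log_pow]
          push_cast
          nlinarith [Real.log_two_lt_d9, (Nat.cast_nonneg ν : (0 : ℝ) ≤ ν)]
        have h5 : 1 + Real.log (2 ^ (ν + 1) * W) ≤ (ν + 2) * (1 + Real.log W) := by
          nlinarith [mul_nonneg (Nat.cast_nonneg ν : (0 : ℝ) ≤ ν) hlog]
        have h6 : (2 ^ ν * W) ^ (-s) = q ^ ν * (2 ^ ν)⁻¹ * (W ^ (1 - s) * W⁻¹) := by
          have hp : ∀ x : ℝ, 0 < x → x ^ (-s) = x ^ (1 - s) * x⁻¹ := fun x hx => by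
            rw [← Real.rpow_neg_one x, ← Real.rpow_add hx]
            ring_nf
          rw [Real.mul_rpow (by positivity) hW0.le, hp W hW0, hp _ (by positivity), hq,
            ← Real.rpow_natCast (2 ^ (1 - s)) ν, ← Real.rpow_mul (by norm_num),
            ← Real.rpow_natCast 2 ν, ← Real.rpow_mul (by norm_num), mul_comm (ν : ℝ) (1 - s)]
        calc ((cross (d + 1) (2 ^ (ν + 1) * W)).card : ℝ) * (2 ^ ν * W) ^ (-s)
            ≤ (2 ^ (d + 1) * (2 ^ (ν + 1) * W) * ((ν + 2) * (1 + Real.log W)) ^ d)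
              * (2 ^ ν * W) ^ (-s) := by
              refine mul_le_mul_of_nonneg_right ((card_cross_le d _ h3).trans ?_) (by positivity)
              refine mul_le_mul_of_nonneg_left ?_ (by positivity)
              exact pow_le_pow_left₀ (by linarith [Real.log_nonneg h3]) h5 d
          _ = _ := by
              rw [h6, mul_pow]
              field_simp
              ring
    _ = _ := by
        rw [← ENNReal.ofReal_tsum_of_nonneg (fun ν => by positivity) (hsum.mul_left _),
          tsum_mul_left, ← hS]
        ring_nf

lemma sum_mul_cosh_add_le {κ : Type*} (Λ : Finset κ) (w a : κ → ℝ) (hw : ∀ k ∈ Λ, 0 ≤ w k)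
    (hw1 : ∑ k ∈ Λ, w k = 1) (ha : ∀ k ∈ Λ, |a k| ≤ 1) (hmean : ∑ k ∈ Λ, w k * a k = 0)
    (v t : ℝ) :
    ∑ k ∈ Λ, w k * Real.cosh (v + t * a k) ≤ Real.cosh v * Real.exp (t ^ 2 / 2) := by
  have hconv : ∀ u ∈ Set.Icc (-1 : ℝ) 1, ∀ b : ℝ,
      Real.exp (b * u) ≤ Real.cosh b + u * Real.sinh b := by
    intro u hu b
    have h := convexOn_exp.2 (Set.mem_univ b) (Set.mem_univ (-b))
      (show 0 ≤ (1 + u) / 2 by linarith [hu.1]) (show 0 ≤ (1 - u) / 2 by linarith [hu.2])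
      (by ring)
    simp only [smul_eq_mul] at h
    rw [Real.cosh_eq, Real.sinh_eq]
    calc Real.exp (b * u) = Real.exp ((1 + u) / 2 * b + (1 - u) / 2 * -b) := by ring_nf
      _ ≤ _ := h
      _ = _ := by ring
  have hterm : ∀ k ∈ Λ, w k * Real.cosh (v + t * a k) ≤
      w k * (Real.cosh v * Real.cosh t) + (w k * a k) * (Real.sinh v * Real.sinh t) := by
    intro k hk
    have h1 := hconv (a k) (abs_le.mp (ha k hk)) t
    have h2 := hconv (a k) (abs_le.mp (ha k hk)) (-t)
    rw [Real.cosh_neg, Real.sinh_neg] at h2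
    have h3 : Real.cosh (v + t * a k) =
        (Real.exp v * Real.exp (t * a k) + Real.exp (-v) * Real.exp (-t * a k)) / 2 := by
      rw [Real.cosh_eq, ← Real.exp_add, ← Real.exp_add]
      ring_nf
    have h4 : Real.cosh (v + t * a k) ≤
        Real.cosh v * Real.cosh t + a k * (Real.sinh v * Real.sinh t) := by
      rw [h3, Real.cosh_eq v, Real.sinh_eq v]
      nlinarith [mul_le_mul_of_nonneg_left h1 (Real.exp_pos v).le,
        mul_le_mul_of_nonneg_left h2 (Real.exp_pos (-v)).le]
    nlinarith [mul_le_mul_of_nonneg_left h4 (hw k hk)]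
  calc ∑ k ∈ Λ, w k * Real.cosh (v + t * a k)
      ≤ ∑ k ∈ Λ, (w k * (Real.cosh v * Real.cosh t) +
          (w k * a k) * (Real.sinh v * Real.sinh t)) := Finset.sum_le_sum hterm
    _ = Real.cosh v * Real.cosh t := by
        rw [Finset.sum_add_distrib, ← Finset.sum_mul, ← Finset.sum_mul, hw1, hmean]
        ring
    _ ≤ _ := mul_le_mul_of_nonneg_left (Real.cosh_le_exp_half_sq t) (Real.cosh_pos v).le

/-- One greedy step: the exponential potential grows by at most `exp (t² / 2)`. -/
lemma exists_sum_cosh_add_le {κ ι : Type*} (Λ : Finset κ) (Y : Finset ι) (w : κ → ℝ)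
    (a : κ → ι → ℝ) (hw : ∀ k ∈ Λ, 0 ≤ w k) (hw1 : ∑ k ∈ Λ, w k = 1)
    (ha : ∀ k ∈ Λ, ∀ y ∈ Y, |a k y| ≤ 1) (hmean : ∀ y ∈ Y, ∑ k ∈ Λ, w k * a k y = 0)
    (v : ι → ℝ) (t : ℝ) :
    ∃ k ∈ Λ, ∑ y ∈ Y, Real.cosh (v y + t * a k y) ≤
      (∑ y ∈ Y, Real.cosh (v y)) * Real.exp (t ^ 2 / 2) := by
  by_contra! hcon
  set B := (∑ y ∈ Y, Real.cosh (v y)) * Real.exp (t ^ 2 / 2)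
  have h1 : ∑ k ∈ Λ, w k * ∑ y ∈ Y, Real.cosh (v y + t * a k y) ≤ B := by
    simp_rw [Finset.mul_sum]
    rw [Finset.sum_comm, show B = _ from Finset.sum_mul _ _ _]
    exact Finset.sum_le_sum fun y hy =>
      sum_mul_cosh_add_le Λ w (fun k => a k y) hw hw1 (fun k hk => ha k hk y hy) (hmean y hy) _ _
  have h2 : ∑ k ∈ Λ, w k * B < ∑ k ∈ Λ, w k * ∑ y ∈ Y, Real.cosh (v y + t * a k y) := by
    refine Finset.sum_lt_sum
      (fun k hk => mul_le_mul_of_nonneg_left (hcon k hk).le (hw k hk)) ?_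
    obtain ⟨k, hk, hk0⟩ : ∃ k ∈ Λ, 0 < w k := by
      by_contra! h
      linarith [Finset.sum_nonpos h]
    exact ⟨k, hk, mul_lt_mul_of_pos_left (hcon k hk) hk0⟩
  rw [← Finset.sum_mul, hw1, one_mul] at h2
  linarith

lemma exists_counts_sum_cosh_le {κ ι : Type*} (Λ : Finset κ) (Y : Finset ι) (w : κ → ℝ)
    (a : κ → ι → ℝ) (hw : ∀ k ∈ Λ, 0 ≤ w k) (hw1 : ∑ k ∈ Λ, w k = 1)
    (ha : ∀ k ∈ Λ, ∀ y ∈ Y, |a k y| ≤ 1) (hmean : ∀ y ∈ Y, ∑ k ∈ Λ, w k * a k y = 0)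
    (t : ℝ) (m : ℕ) :
    ∃ n : κ → ℕ, ∑ k ∈ Λ, n k = m ∧
      ∑ y ∈ Y, Real.cosh (t * ∑ k ∈ Λ, n k * a k y) ≤ Y.card * Real.exp (m * t ^ 2 / 2) := by
  classical
  induction m with
  | zero => exact ⟨0, by simp, by simp⟩
  | succ m ih =>
    obtain ⟨n, hn, hle⟩ := ih
    obtain ⟨k₀, hk₀, h⟩ := exists_sum_cosh_add_le Λ Y w a hw hw1 ha hmean
      (fun y => t * ∑ k ∈ Λ, n k * a k y) t
    refine ⟨fun k => n k + if k = k₀ then 1 else 0, ?_, ?_⟩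
    · simp [Finset.sum_add_distrib, hn, hk₀]
    · calc ∑ y ∈ Y, Real.cosh (t * ∑ k ∈ Λ, ((n k + if k = k₀ then 1 else 0 : ℕ) : ℝ) * a k y)
          = ∑ y ∈ Y, Real.cosh (t * ∑ k ∈ Λ, n k * a k y + t * a k₀ y) := by
            refine Finset.sum_congr rfl fun y _ => ?_
            simp [add_mul, Finset.sum_add_distrib, hk₀, mul_add]
        _ ≤ _ := h
        _ ≤ (Y.card * Real.exp (m * t ^ 2 / 2)) * Real.exp (t ^ 2 / 2) :=
            mul_le_mul_of_nonneg_right hle (Real.exp_pos _).le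
        _ = _ := by
            rw [mul_assoc, ← Real.exp_add]
            push_cast
            ring_nf

/-- Empirical approximation of a mean, uniformly over a finite set of functionals. -/
lemma exists_counts_abs_sum_le {κ ι : Type*} (Λ : Finset κ) (Y : Finset ι) (w : κ → ℝ)
    (u : κ → ι → ℝ) (hw : ∀ k ∈ Λ, 0 ≤ w k) (hw1 : ∑ k ∈ Λ, w k = 1)
    (hu : ∀ k ∈ Λ, ∀ y ∈ Y, |u k y| ≤ 1) (m : ℕ) (hm : 0 < m) (hY : 0 < Y.card) :
    ∃ n : κ → ℕ, ∑ k ∈ Λ, n k = m ∧ ∀ y ∈ Y,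
      |∑ k ∈ Λ, n k * u k y - m * ∑ k ∈ Λ, w k * u k y| ≤
        3 * √(m * Real.log (2 * Y.card)) := by
  set μ : ι → ℝ := fun y => ∑ k ∈ Λ, w k * u k y
  have hμ : ∀ y ∈ Y, |μ y| ≤ 1 := fun y hy => by
    refine (Finset.abs_sum_le_sum_abs _ _).trans ?_
    rw [← hw1]
    refine Finset.sum_le_sum fun k hk => ?_
    rw [abs_mul, abs_of_nonneg (hw k hk)]
    exact mul_le_of_le_one_right (hw k hk) (hu k hk y hy)
  set ℓ := Real.log (2 * Y.card) with hℓdef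
  have hY1 : (1 : ℝ) ≤ Y.card := by exact_mod_cast hY
  have hm0 : (0 : ℝ) < m := by exact_mod_cast hm
  have hℓ : 0 < ℓ := Real.log_pos (by linarith)
  set t := 2 * √(ℓ / m) with ht
  have hs : 0 < √(ℓ / m) := Real.sqrt_pos.mpr (by positivity)
  have ht0 : 0 < t := by positivity
  obtain ⟨n, hn, hle⟩ := exists_counts_sum_cosh_le Λ Y w (fun k y => (u k y - μ y) / 2) hw hw1
    (fun k hk y hy => by
      rw [abs_div, abs_two, div_le_one two_pos]
      exact (abs_sub _ _).trans (by linarith [hu k hk y hy, hμ y hy]))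
    (fun y hy => by
      have : ∑ k ∈ Λ, w k * ((u k y - μ y) / 2) =
          ((∑ k ∈ Λ, w k * u k y) - (∑ k ∈ Λ, w k) * μ y) / 2 := by
        rw [Finset.sum_mul, ← Finset.sum_sub_distrib, Finset.sum_div]
        exact Finset.sum_congr rfl fun k _ => by ring
      rw [this, hw1]
      simp [μ]) t m
  refine ⟨n, hn, fun y hy => ?_⟩
  set D := ∑ k ∈ Λ, n k * u k y - m * ∑ k ∈ Λ, w k * u k y with hD
  have h1 : ∑ k ∈ Λ, (n k : ℝ) * ((u k y - μ y) / 2) = D / 2 := by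
    have : ∑ k ∈ Λ, (n k : ℝ) * ((u k y - μ y) / 2) =
        ((∑ k ∈ Λ, n k * u k y) - (∑ k ∈ Λ, (n k : ℝ)) * μ y) / 2 := by
      rw [Finset.sum_mul, ← Finset.sum_sub_distrib, Finset.sum_div]
      exact Finset.sum_congr rfl fun k _ => by ring
    rw [this, ← Nat.cast_sum, hn]
  have h2 : Real.cosh (t * (D / 2)) ≤ Y.card * Real.exp (m * t ^ 2 / 2) := by
    rw [← h1]
    refine le_trans ?_ hle
    exact Finset.single_le_sum (f := fun y => Real.cosh (t * ∑ k ∈ Λ, n k * ((u k y - μ y) / 2)))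
      (fun _ _ => (Real.cosh_pos _).le) hy
  have h3 : Real.exp |t * (D / 2)| ≤ 2 * Real.cosh (t * (D / 2)) := by
    rw [← Real.cosh_abs, Real.cosh_eq]
    linarith [Real.exp_pos (-|t * (D / 2)|)]
  have h4 : Real.exp |t * (D / 2)| ≤ Real.exp (ℓ + m * t ^ 2 / 2) := by
    rw [Real.exp_add, hℓdef, Real.exp_log (by positivity)]
    linarith
  have h5 := Real.exp_le_exp.mp h4
  have h6 : √(ℓ / m) ^ 2 = ℓ / m := Real.sq_sqrt (by positivity)
  have h7 : m * t ^ 2 / 2 = 2 * ℓ := by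
    rw [ht, mul_pow, h6]
    field_simp
  have h8 : √(m * ℓ) = m * √(ℓ / m) := by
    rw [show (m : ℝ) * ℓ = (m : ℝ) ^ 2 * (ℓ / m) by field_simp,
      Real.sqrt_mul (by positivity), Real.sqrt_sq hm0.le]
  have h9 : |t * (D / 2)| = √(ℓ / m) * |D| := by
    rw [abs_mul, abs_of_pos ht0, abs_div, abs_two, ht]
    ring
  rw [h9, h7] at h5
  rw [h8]
  refine le_of_mul_le_mul_left ?_ hs
  calc √(ℓ / m) * |D| ≤ ℓ + 2 * ℓ := h5
    _ = √(ℓ / m) * (3 * (m * √(ℓ / m))) := by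
      rw [show √(ℓ / m) * (3 * (m * √(ℓ / m))) = 3 * m * √(ℓ / m) ^ 2 by ring, h6]
      field_simp
      norm_num

lemma norm_expk (d : ℕ) (k : Fin d → ℤ) (x : Fin d → ℝ) : ‖expk d k x‖ = 1 :=
  Complex.norm_exp_ofReal_mul_I _

lemma norm_exp_mul_I_sub_le (a b : ℝ) :
    ‖Complex.exp ((a : ℂ) * Complex.I) - Complex.exp ((b : ℂ) * Complex.I)‖ ≤ |a - b| := by
  have h : Complex.exp ((a : ℂ) * Complex.I) - Complex.exp ((b : ℂ) * Complex.I) =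
      Complex.exp ((b : ℂ) * Complex.I) * (Complex.exp (Complex.I * ((a - b : ℝ) : ℂ)) - 1) := by
    rw [mul_sub, ← Complex.exp_add, mul_one]
    push_cast
    ring_nf
  rw [h, norm_mul, Complex.norm_exp_ofReal_mul_I, one_mul]
  exact Real.norm_exp_I_mul_ofReal_sub_one_le

lemma norm_expk_sub_le {d : ℕ} {k : Fin d → ℤ} {M δ : ℝ} (hM : ∀ i, |(k i : ℝ)| ≤ M)
    {x y : Fin d → ℝ} (hxy : ∀ i, |x i - y i| ≤ δ) :
    ‖expk d k x - expk d k y‖ ≤ 2 * Real.pi * d * M * δ := by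
  refine (norm_exp_mul_I_sub_le _ _).trans ?_
  have h1 : |∑ i, (k i : ℝ) * x i - ∑ i, (k i : ℝ) * y i| ≤ d * (M * δ) := by
    rw [← Finset.sum_sub_distrib]
    refine (Finset.abs_sum_le_sum_abs _ _).trans ?_
    calc ∑ i, |(k i : ℝ) * x i - (k i : ℝ) * y i| ≤ ∑ _i : Fin d, M * δ := by
          refine Finset.sum_le_sum fun i _ => ?_
          rw [← mul_sub, abs_mul]
          exact mul_le_mul (hM i) (hxy i) (abs_nonneg _) ((abs_nonneg _).trans (hM i))
      _ = _ := by simp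
  rw [← mul_sub, abs_mul, abs_of_pos (by positivity : (0 : ℝ) < 2 * Real.pi)]
  calc 2 * Real.pi * |∑ i, (k i : ℝ) * x i - ∑ i, (k i : ℝ) * y i|
      ≤ 2 * Real.pi * (d * (M * δ)) := mul_le_mul_of_nonneg_left h1 (by positivity)
    _ = _ := by ring

lemma zero_mem_trigPoly (d m : ℕ) : (fun _ => 0) ∈ trigPoly d m := ⟨∅, 0, by simp, by simp⟩

lemma exists_grid_near {d L : ℕ} (hL : 0 < L) {x : Fin d → ℝ} (hx : x ∈ cube d) :
    ∃ g : Fin d → Fin L, ∀ i, |x i - (g i : ℝ) / L| ≤ 1 / L := by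
  have hL0 : (0 : ℝ) < L := by exact_mod_cast hL
  have hx' : ∀ i, 0 ≤ x i ∧ x i < 1 := fun i => hx i (Set.mem_univ i)
  refine ⟨fun i => ⟨⌊x i * L⌋₊, ?_⟩, fun i => ?_⟩
  · rw [Nat.floor_lt (mul_nonneg (hx' i).1 hL0.le)]
    nlinarith [(hx' i).2]
  · have h1 := Nat.floor_le (mul_nonneg (hx' i).1 hL0.le)
    have h2 := Nat.lt_floor_add_one (x i * L)
    rw [show x i - ((⌊x i * L⌋₊ : ℕ) : ℝ) / L = (x i * L - ⌊x i * L⌋₊) / L by field_simp, abs_div,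
      abs_of_pos hL0]
    refine div_le_div_of_nonneg_right ?_ hL0.le
    rw [abs_le]
    constructor <;> linarith

/-- Sparse approximation in the uniform norm of a trigonometric polynomial with small Wiener
norm. -/
lemma exists_sparse_approx {d : ℕ} (Λ : Finset (Fin d → ℤ)) (c : (Fin d → ℤ) → ℂ) {M : ℝ}
    (hM : ∀ k ∈ Λ, ∀ i, |(k i : ℝ)| ≤ M) (hM0 : 0 ≤ M) {m L : ℕ} (hm : 0 < m) (hL : 0 < L) :
    ∃ s ∈ trigPoly d m, ∀ x ∈ cube d, ‖∑ k ∈ Λ, c k * expk d k x - s x‖ ≤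
      (∑ k ∈ Λ, ‖c k‖) * (4 * Real.pi * d * M / L + 6 * √(Real.log (4 * L ^ d) / m)) := by
  classical
  set A := ∑ k ∈ Λ, ‖c k‖ with hA
  have hA0 : 0 ≤ A := Finset.sum_nonneg fun _ _ => norm_nonneg _
  have hm0 : (0 : ℝ) < m := by exact_mod_cast hm
  have hL0 : (0 : ℝ) < L := by exact_mod_cast hL
  rcases hA0.eq_or_lt with hAz | hApos
  · refine ⟨_, zero_mem_trigPoly d m, fun x _ => ?_⟩
    have hz : ∀ k ∈ Λ, c k = 0 := fun k hk => by
      have := (Finset.sum_eq_zero_iff_of_nonneg fun k _ => norm_nonneg (c k)).mp hAz.symm k hk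
      exact norm_eq_zero.mp this
    rw [Finset.sum_eq_zero fun k hk => by rw [hz k hk, zero_mul], ← hAz]
    simp
  set ph : (Fin d → ℤ) → ℂ := fun k => c k / ‖c k‖
  have hph : ∀ k, ‖ph k‖ ≤ 1 := fun k => by
    simp only [ph, norm_div, Complex.norm_real, norm_norm]
    exact div_self_le_one _
  have hcph : ∀ k, (‖c k‖ : ℂ) * ph k = c k := fun k => by
    by_cases h : c k = 0
    · simp [h]
    · have : (‖c k‖ : ℂ) ≠ 0 := by simpa using h
      simp only [ph]
      field_simp
  set pt : (Fin d → Fin L) → (Fin d → ℝ) := fun g i => (g i : ℝ) / L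
  set z : (Fin d → ℤ) → (Fin d → Fin L) → ℂ := fun k g => ph k * expk d k (pt g)
  have hz : ∀ k g, ‖z k g‖ ≤ 1 := fun k g => by
    rw [norm_mul, norm_expk, mul_one]
    exact hph k
  obtain ⟨n, hn, hle⟩ := exists_counts_abs_sum_le Λ
    (Finset.univ : Finset ((Fin d → Fin L) × Bool)) (fun k => ‖c k‖ / A)
    (fun k y => if y.2 then (z k y.1).re else (z k y.1).im)
    (fun k _ => by positivity) (by rw [← Finset.sum_div, ← hA, div_self hApos.ne'])
    (fun k _ y _ => by
      split_ifs
      · exact (Complex.abs_re_le_norm _).trans (hz _ _)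
      · exact (Complex.abs_im_le_norm _).trans (hz _ _)) m hm
    (by simp only [Finset.card_univ, Fintype.card_prod, Fintype.card_bool, Fintype.card_pi,
          Fintype.card_fin, Finset.prod_const]
        positivity)
  have hcard : ((Finset.univ : Finset ((Fin d → Fin L) × Bool)).card : ℝ) = L ^ d * 2 := by
    simp
  set T := √(m * Real.log (4 * L ^ d)) with hT
  rw [hcard, show (2 : ℝ) * (L ^ d * 2) = 4 * L ^ d by ring, ← hT] at hle
  set b : (Fin d → ℤ) → ℂ := fun k => (A / m * n k : ℝ) * ph k
  set s : (Fin d → ℝ) → ℂ := fun x => ∑ k ∈ Λ, b k * expk d k x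
  have hb : ∑ k ∈ Λ, ‖b k‖ ≤ A := by
    calc ∑ k ∈ Λ, ‖b k‖ ≤ ∑ k ∈ Λ, A / m * n k := by
          refine Finset.sum_le_sum fun k _ => ?_
          rw [norm_mul, Complex.norm_real, Real.norm_of_nonneg (by positivity)]
          exact mul_le_of_le_one_right (by positivity) (hph k)
      _ = A := by
          rw [← Finset.mul_sum, ← Nat.cast_sum, hn]
          field_simp
  refine ⟨s, ⟨Λ.filter fun k => n k ≠ 0, b, ?_, ?_⟩, fun x hx => ?_⟩
  · rw [← hn]
    calc (Λ.filter fun k => n k ≠ 0).card = ∑ k ∈ Λ.filter (fun k => n k ≠ 0), 1 := by simp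
      _ ≤ ∑ k ∈ Λ.filter (fun k => n k ≠ 0), n k := Finset.sum_le_sum fun k hk =>
          Nat.one_le_iff_ne_zero.mpr (Finset.mem_filter.mp hk).2
      _ ≤ ∑ k ∈ Λ, n k := Finset.sum_le_sum_of_subset (Finset.filter_subset _ _)
  · funext x
    rw [Finset.sum_filter_of_ne]
    intro k _ hk h0
    simp [b, h0] at hk
  · obtain ⟨g, hg⟩ := exists_grid_near hL hx
    have hgrid : ‖∑ k ∈ Λ, (c k - b k) * expk d k (pt g)‖ ≤ A * (6 * √(Real.log (4 * L ^ d) / m)) := by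
      have hsum : ∑ k ∈ Λ, (c k - b k) * expk d k (pt g) =
          (-(A / m) : ℝ) * (∑ k ∈ Λ, (n k : ℂ) * z k g - m * ∑ k ∈ Λ, ((‖c k‖ / A : ℝ) : ℂ) * z k g) := by
        rw [Finset.mul_sum, ← Finset.sum_sub_distrib, Finset.mul_sum]
        refine Finset.sum_congr rfl fun k _ => ?_
        conv_lhs => rw [← hcph k]
        have h1 : (A : ℂ) ≠ 0 := by exact_mod_cast hApos.ne'
        have h2 : (m : ℂ) ≠ 0 := by exact_mod_cast hm.ne'
        simp only [b, z]
        push_cast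
        field_simp
        ring
      set D := ∑ k ∈ Λ, (n k : ℂ) * z k g - m * ∑ k ∈ Λ, ((‖c k‖ / A : ℝ) : ℂ) * z k g with hD
      have hre : |D.re| ≤ 3 * T := by
        refine le_trans (le_of_eq ?_) (hle (g, true) (Finset.mem_univ _))
        simp only [hD, Complex.sub_re, Complex.re_sum, if_true, ← Complex.ofReal_natCast,
          Complex.re_ofReal_mul]
      have him : |D.im| ≤ 3 * T := by
        refine le_trans (le_of_eq ?_) (hle (g, false) (Finset.mem_univ _))
        simp only [hD, Complex.sub_im, Complex.im_sum, ← Complex.ofReal_natCast,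
          Complex.im_ofReal_mul, Bool.false_eq_true, if_false]
      have hDn : ‖D‖ ≤ 6 * T := by linarith [Complex.norm_le_abs_re_add_abs_im D]
      rw [hsum, norm_mul, Complex.norm_real, norm_neg, Real.norm_of_nonneg (by positivity)]
      have hTm : √(Real.log (4 * L ^ d) / m) = T / m := by
        have h1 : (1 : ℝ) ≤ L ^ d := one_le_pow₀ (by exact_mod_cast hL)
        rw [hT, show Real.log (4 * L ^ d) / m = m * Real.log (4 * L ^ d) / m ^ 2 by field_simp,
          Real.sqrt_div (mul_nonneg hm0.le (Real.log_nonneg (by linarith))), Real.sqrt_sq hm0.le]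
      rw [hTm]
      calc A / m * ‖D‖ ≤ A / m * (6 * T) := mul_le_mul_of_nonneg_left hDn (by positivity)
        _ = _ := by ring
    have hdiff : ‖∑ k ∈ Λ, (c k - b k) * (expk d k x - expk d k (pt g))‖ ≤
        A * (4 * Real.pi * d * M / L) := by
      refine (norm_sum_le _ _).trans ?_
      calc ∑ k ∈ Λ, ‖(c k - b k) * (expk d k x - expk d k (pt g))‖
          ≤ ∑ k ∈ Λ, (‖c k‖ + ‖b k‖) * (2 * Real.pi * d * M * (1 / L)) := by
            refine Finset.sum_le_sum fun k hk => ?_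
            rw [norm_mul]
            exact mul_le_mul (norm_sub_le _ _) (norm_expk_sub_le (hM k hk) hg) (norm_nonneg _)
              (by positivity)
        _ = (A + ∑ k ∈ Λ, ‖b k‖) * (2 * Real.pi * d * M * (1 / L)) := by
            rw [← Finset.sum_mul, Finset.sum_add_distrib]
        _ ≤ (A + A) * (2 * Real.pi * d * M * (1 / L)) := by gcongr
        _ = _ := by ring
    have hsplit : ∑ k ∈ Λ, c k * expk d k x - s x =
        ∑ k ∈ Λ, (c k - b k) * (expk d k x - expk d k (pt g)) +
          ∑ k ∈ Λ, (c k - b k) * expk d k (pt g) := by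
      simp only [s]
      rw [← Finset.sum_sub_distrib, ← Finset.sum_add_distrib]
      exact Finset.sum_congr rfl fun k _ => by ring
    rw [hsplit, mul_add]
    exact (norm_add_le _ _).trans (add_le_add hdiff hgrid)

section Torus

attribute [local instance] instMeasureSpaceUnitAddCircle

lemma ae_eq_zero_of_forall_mFourierCoeff_eq_zero {ι : Type*} [Fintype ι] {g : UnitAddTorus ι → ℂ}
    (hg : Integrable g) (h : ∀ n, UnitAddTorus.mFourierCoeff g n = 0) : g =ᵐ[volume] 0 := by
  have hmul_int : ∀ G : C(UnitAddTorus ι, ℂ), Integrable fun x => G x * g x := fun G =>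
    hg.bdd_mul G.continuous.aestronglyMeasurable (c := ‖G‖)
      (Filter.Eventually.of_forall fun x => G.norm_coe_le_norm x)
  let φ : C(UnitAddTorus ι, ℂ) →ₗ[ℂ] ℂ :=
    { toFun := fun G => ∫ x, G x * g x
      map_add' := fun G H => by
        rw [← integral_add (hmul_int G) (hmul_int H)]
        simp [add_mul]
      map_smul' := fun a G => by
        simp only [ContinuousMap.coe_smul, Pi.smul_apply, smul_eq_mul, RingHom.id_apply,
          mul_assoc]
        rw [integral_const_mul] }
  have hφ : Continuous φ := by
    refine (φ.mkContinuous (∫ x, ‖g x‖) fun G => ?_).continuous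
    rw [← integral_mul_const]
    refine norm_integral_le_of_norm_le (hg.norm.mul_const _) (Filter.Eventually.of_forall fun x => ?_)
    rw [norm_mul, mul_comm]
    exact mul_le_mul_of_nonneg_left (G.norm_coe_le_norm x) (norm_nonneg _)
  have hker : ∀ G, φ G = 0 := by
    have h1 : Submodule.span ℂ (Set.range (UnitAddTorus.mFourier (d := ι))) ≤ φ.ker := by
      rw [Submodule.span_le]
      rintro _ ⟨n, rfl⟩
      have := h (-n)
      simpa [UnitAddTorus.mFourierCoeff, φ] using this
    have h2 := Submodule.topologicalClosure_minimal _ h1 (isClosed_singleton.preimage hφ)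
    rw [UnitAddTorus.span_mFourier_closure_eq_top] at h2
    exact fun G => h2 (Submodule.mem_top)
  refine ae_eq_zero_of_forall_setIntegral_isClosed_eq_zero hg fun K hK => ?_
  rw [← integral_indicator hK.measurableSet]
  have hlim : Filter.Tendsto (fun n => ∫ x, ((hK.apprSeq n x : ℝ) : ℂ) * g x) Filter.atTop
      (nhds (∫ x, K.indicator g x)) := by
    refine tendsto_integral_of_dominated_convergence (fun x => ‖g x‖) (fun n => ?_) hg.norm
      (fun n => ?_) ?_
    · have hc : Continuous fun x => ((hK.apprSeq n x : ℝ) : ℂ) := by fun_prop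
      exact hc.aestronglyMeasurable.mul hg.aestronglyMeasurable
    · refine Filter.Eventually.of_forall fun x => ?_
      rw [norm_mul, Complex.norm_real, Real.norm_of_nonneg (NNReal.coe_nonneg _)]
      refine mul_le_of_le_one_left (norm_nonneg _) ?_
      exact_mod_cast HasOuterApproxClosed.apprSeq_apply_le_one hK n x
    · refine Filter.Eventually.of_forall fun x => ?_
      have h1 := (tendsto_pi_nhds.mp (HasOuterApproxClosed.tendsto_apprSeq hK)) x
      have h2 : Filter.Tendsto (fun n => ((hK.apprSeq n x : ℝ) : ℂ) * g x) Filter.atTop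
          (nhds ((((K.indicator (fun _ => (1 : NNReal)) x : NNReal) : ℝ) : ℂ) * g x)) :=
        ((Complex.continuous_ofReal.tendsto _).comp
          ((NNReal.continuous_coe.tendsto _).comp h1)).mul_const _
      convert h2 using 2
      by_cases hx : x ∈ K <;> simp [hx]
  refine tendsto_nhds_unique hlim ?_
  have : ∀ n, ∫ x, ((hK.apprSeq n x : ℝ) : ℂ) * g x = 0 := fun n =>
    hker ⟨fun x => ((hK.apprSeq n x : ℝ) : ℂ), by fun_prop⟩
  simp [this]

lemma expk_eq_mFourier (d : ℕ) (k : Fin d → ℤ) (x : Fin d → ℝ) :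
    expk d k x = UnitAddTorus.mFourier k (fun i => (x i : UnitAddCircle)) := by
  simp only [expk, UnitAddTorus.mFourier, ContinuousMap.coe_mk, fourier_coe_apply]
  rw [← Complex.exp_sum]
  congr 1
  push_cast
  rw [Finset.mul_sum, Finset.sum_mul]
  refine Finset.sum_congr rfl fun i _ => ?_
  simp
  ring

lemma continuous_expk (d : ℕ) (k : Fin d → ℤ) : Continuous (expk d k) := by
  unfold expk
  fun_prop

lemma expk_add (d : ℕ) (k l : Fin d → ℤ) (x : Fin d → ℝ) :
    expk d (k + l) x = expk d k x * expk d l x := by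
  rw [expk, expk, expk, ← Complex.exp_add, ← add_mul, ← Complex.ofReal_add]
  simp [add_mul, Finset.sum_add_distrib, mul_add]

lemma conj_expk (d : ℕ) (k : Fin d → ℤ) (x : Fin d → ℝ) :
    (starRingEnd ℂ) (expk d k x) = expk d (-k) x := by
  rw [expk_eq_mFourier, expk_eq_mFourier, UnitAddTorus.mFourier_neg]

lemma measurableSet_cube (d : ℕ) : MeasurableSet (cube d) :=
  MeasurableSet.univ_pi fun _ => measurableSet_Ico

instance (d : ℕ) : IsProbabilityMeasure (volume.restrict (cube d)) :=
  ⟨by simp [cube, Real.volume_pi_Ico]⟩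

lemma cube_ae_eq (d : ℕ) :
    (cube d : Set (Fin d → ℝ)) =ᵐ[volume]
      {x : Fin d → ℝ | ∀ i, x i ∈ Set.Ioc ((0 : Fin d → ℝ) i) ((0 : Fin d → ℝ) i + 1)} := by
  have h1 : (cube d) =ᵐ[volume] Set.Icc (0 : Fin d → ℝ) 1 :=
    Measure.univ_pi_Ico_ae_eq_Icc (μ := fun _ : Fin d => (volume : Measure ℝ))
      (f := (0 : Fin d → ℝ)) (g := 1)
  have h2 : (Set.univ.pi fun i => Set.Ioc ((0 : Fin d → ℝ) i) ((1 : Fin d → ℝ) i)) =ᵐ[volume]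
      Set.Icc (0 : Fin d → ℝ) 1 :=
    Measure.univ_pi_Ioc_ae_eq_Icc (μ := fun _ : Fin d => (volume : Measure ℝ))
  have h3 : (Set.univ.pi fun i => Set.Ioc ((0 : Fin d → ℝ) i) ((1 : Fin d → ℝ) i)) =
      {x : Fin d → ℝ | ∀ i, x i ∈ Set.Ioc ((0 : Fin d → ℝ) i) ((0 : Fin d → ℝ) i + 1)} := by
    ext x
    simp
  rw [h3] at h2
  exact h1.trans h2.symm

lemma integral_cube_mFourier (d : ℕ) (G : UnitAddTorus (Fin d) → ℂ) :
    ∫ x in cube d, G (fun i => (x i : UnitAddCircle)) = ∫ y, G y := by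
  rw [UnitAddTorus.integral_preimage G 0, setIntegral_congr_set (cube_ae_eq d)]

lemma integral_expk (d : ℕ) (k : Fin d → ℤ) :
    ∫ x in cube d, expk d k x = if k = 0 then 1 else 0 := by
  simp_rw [expk_eq_mFourier]
  rw [integral_cube_mFourier d (UnitAddTorus.mFourier k)]
  have h := (orthonormal_iff_ite.mp (UnitAddTorus.orthonormal_mFourier (d := Fin d))) 0 k
  simp only [ContinuousMap.inner_toLp, ← UnitAddTorus.mFourier_neg,
    ← UnitAddTorus.mFourier_add] at h
  simpa [eq_comm] using h

/-- Uniqueness theorem for Fourier coefficients of integrable functions on the cube. -/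
lemma ae_eq_zero_of_forall_fCoeff_eq_zero {d : ℕ} {f : (Fin d → ℝ) → ℂ}
    (hf : IntegrableOn f (cube d)) (h : ∀ k, fCoeff d f k = 0) :
    ∀ᵐ x ∂volume.restrict (cube d), f x = 0 := by
  set B : Set (Fin d → ℝ) :=
    {x | ∀ i, x i ∈ Set.Ioc ((0 : Fin d → ℝ) i) ((0 : Fin d → ℝ) i + 1)} with hB
  have hBm : MeasurableSet B := MeasurableSet.univ_pi' fun i => measurableSet_Ioc
  set e := UnitAddTorus.measurableEquivPiIoc (0 : Fin d → ℝ)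
  have he : MeasurePreserving e volume (Measure.comap Subtype.val volume) :=
    UnitAddTorus.measurePreserving_equivPiIoc 0
  have hfB : IntegrableOn f B := hf.congr_set_ae (cube_ae_eq d).symm
  set g : UnitAddTorus (Fin d) → ℂ := fun y => f (e y).1 with hgdef
  have hg : Integrable g :=
    (he.integrable_comp_emb e.measurableEmbedding (g := f ∘ Subtype.val)).mpr
      ((integrableOn_iff_comap_subtypeVal hBm).mp hfB)
  have hge : ∀ x ∈ B, g (fun i => (x i : UnitAddCircle)) = f x := by
    intro x hx
    have h1 : (fun i => (x i : UnitAddCircle)) = e.symm ⟨x, hx⟩ := rfl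
    rw [hgdef, h1]
    simp only [MeasurableEquiv.apply_symm_apply]
  have hg0 : g =ᵐ[volume] 0 := by
    refine ae_eq_zero_of_forall_mFourierCoeff_eq_zero hg fun n => ?_
    rw [UnitAddTorus.mFourierCoeff_eq_integral g n 0, ← h n, fCoeff,
      setIntegral_congr_set (cube_ae_eq d)]
    refine setIntegral_congr_fun hBm fun x hx => ?_
    simp only [hge x hx, expk_eq_mFourier, smul_eq_mul, mul_comm]
  rw [Measure.restrict_congr_set (cube_ae_eq d), ae_restrict_iff_subtype hBm]
  have h0 := (e.measurableEmbedding.ae_map_iff (p := fun z => f z.1 = 0)).mpr hg0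
  rwa [he.map_eq] at h0

end Torus

lemma integrable_mul_expk {d : ℕ} {f : (Fin d → ℝ) → ℂ} (hf : IntegrableOn f (cube d))
    (k : Fin d → ℤ) : IntegrableOn (fun x => f x * expk d k x) (cube d) :=
  hf.mul_bdd (c := 1) (continuous_expk d k).aestronglyMeasurable
    (Filter.Eventually.of_forall fun x => (norm_expk d k x).le)

lemma integrable_expk (d : ℕ) (k : Fin d → ℤ) : IntegrableOn (expk d k) (cube d) := by
  have h1 : IntegrableOn (fun _ => (1 : ℂ)) (cube d) := integrable_const 1
  have h := integrable_mul_expk h1 k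
  simpa using h

/-- Fourier inversion for integrable functions with summable Fourier coefficients. -/
lemma ae_eq_tsum_fCoeff {d : ℕ} {f : (Fin d → ℝ) → ℂ} (hf : IntegrableOn f (cube d))
    (hs : Summable fun k => ‖fCoeff d f k‖) :
    ∀ᵐ x ∂volume.restrict (cube d), f x = ∑' k, fCoeff d f k * expk d k x := by
  set F : (Fin d → ℝ) → ℂ := fun x => ∑' k, fCoeff d f k * expk d k x with hF
  have hFc : Continuous F := continuous_tsum (u := fun k => ‖fCoeff d f k‖)
    (fun k => continuous_const.mul (continuous_expk d k)) hs
    (fun k x => by rw [norm_mul, norm_expk, mul_one])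
  have hFint : IntegrableOn F (cube d) := by
    refine Integrable.of_bound hFc.aestronglyMeasurable (∑' k, ‖fCoeff d f k‖)
      (Filter.Eventually.of_forall fun x => ?_)
    exact tsum_of_norm_bounded hs.hasSum fun k => by rw [norm_mul, norm_expk, mul_one]
  have hcoef : ∀ k, fCoeff d F k = fCoeff d f k := by
    intro k
    have h1 : ∀ x, F x * expk d (-k) x = ∑' j, fCoeff d f j * expk d (j - k) x := fun x => by
      rw [hF, ← tsum_mul_right]
      exact tsum_congr fun j => by rw [sub_eq_add_neg, expk_add, mul_assoc]
    have h2 := hasSum_integral_of_summable_integral_norm (μ := volume.restrict (cube d))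
      (F := fun j x => fCoeff d f j * expk d (j - k) x)
      (fun j => (integrable_expk d (j - k)).const_mul _)
      (by simpa [norm_mul, norm_expk] using hs)
    simp_rw [← h1] at h2
    rw [fCoeff, ← h2.tsum_eq]
    simp_rw [integral_const_mul, integral_expk]
    rw [tsum_eq_single k]
    · simp
    · intro j hj
      simp [sub_eq_zero, hj]
  have h0 := ae_eq_zero_of_forall_fCoeff_eq_zero (f := fun x => f x - F x) (hf.sub hFint)
    (fun k => by
      have := integral_sub (integrable_mul_expk hf (-k)) (integrable_mul_expk hFint (-k))
      simp only [fCoeff, sub_mul] at this ⊢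
      rw [this]
      exact sub_eq_zero.mpr (hcoef k).symm)
  filter_upwards [h0] with x hx using sub_eq_zero.mp hx

/-- The uniform error of a partial Fourier sum is at most the sum of the remaining coefficients. -/
lemma LqNorm_sub_sum_le {d : ℕ} {f : (Fin d → ℝ) → ℂ} (hf : IntegrableOn f (cube d))
    (hs : ∑' k, ‖fCoeff d f k‖ₑ ≠ ∞) (S : Finset (Fin d → ℤ)) :
    LqNorm d ∞ (fun x => f x - ∑ k ∈ S, fCoeff d f k * expk d k x) ≤
      ∑' k : {k // k ∉ S}, ‖fCoeff d f k‖ₑ := by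
  have hsum : Summable fun k => ‖fCoeff d f k‖ := by
    have h := ENNReal.summable_toReal hs
    simpa using h
  rw [LqNorm, eLpNorm_exponent_top]
  refine eLpNormEssSup_le_of_ae_enorm_bound ?_
  filter_upwards [ae_eq_tsum_fCoeff hf hsum] with x hx
  have hsx : Summable fun k => fCoeff d f k * expk d k x :=
    Summable.of_norm (by simpa [norm_mul, norm_expk] using hsum)
  rw [hx, ← hsx.sum_add_tsum_subtype_compl S, add_sub_cancel_left]
  refine enorm_tsum_le_tsum_enorm.trans (le_of_eq (tsum_congr fun k => ?_))
  rw [enorm_mul, ← ofReal_norm (expk d k x), norm_expk, ENNReal.ofReal_one, mul_one]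

lemma fCoeff_sum_expk (d : ℕ) (S : Finset (Fin d → ℤ)) (c : (Fin d → ℤ) → ℂ) (l : Fin d → ℤ) :
    fCoeff d (fun x => ∑ k ∈ S, c k * expk d k x) l = if l ∈ S then c l else 0 := by
  have h : ∀ x, (∑ k ∈ S, c k * expk d k x) * expk d (-l) x =
      ∑ k ∈ S, c k * expk d (k - l) x := fun x => by
    rw [Finset.sum_mul]
    exact Finset.sum_congr rfl fun k _ => by rw [sub_eq_add_neg, expk_add, mul_assoc]
  rw [fCoeff]
  simp_rw [h]
  rw [integral_finsetSum _ fun k _ => (integrable_expk d (k - l)).const_mul (c k)]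
  simp_rw [integral_const_mul, integral_expk, sub_eq_zero, mul_ite, mul_one, mul_zero]
  rw [Finset.sum_ite_eq']

lemma integrableOn_sum_expk (d : ℕ) (S : Finset (Fin d → ℤ)) (c : (Fin d → ℤ) → ℂ) :
    IntegrableOn (fun x => ∑ k ∈ S, c k * expk d k x) (cube d) :=
  integrable_finsetSum _ fun k _ => (integrable_expk d k).const_mul (c k)

lemma integral_norm_sq_sum_expk (d : ℕ) (S : Finset (Fin d → ℤ)) (c : (Fin d → ℤ) → ℂ) :
    ∫ x in cube d, ‖∑ k ∈ S, c k * expk d k x‖ ^ 2 = ∑ k ∈ S, ‖c k‖ ^ 2 := by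
  set h : (Fin d → ℝ) → ℂ := fun x => ∑ k ∈ S, c k * expk d k x with hh
  have h1 : ∀ x, ((‖h x‖ ^ 2 : ℝ) : ℂ) =
      ∑ l ∈ S, (starRingEnd ℂ) (c l) * (h x * expk d (-l) x) := fun x => by
    rw [Complex.ofReal_pow, ← Complex.mul_conj']
    conv_lhs => rw [hh]
    simp only [map_sum, map_mul, conj_expk]
    rw [Finset.mul_sum]
    refine Finset.sum_congr rfl fun l _ => ?_
    ring
  have h2 : ((∫ x in cube d, ‖h x‖ ^ 2 : ℝ) : ℂ) = ((∑ k ∈ S, ‖c k‖ ^ 2 : ℝ) : ℂ) := by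
    rw [← integral_complex_ofReal]
    simp_rw [h1]
    rw [integral_finsetSum _ fun l _ =>
      (integrable_mul_expk (integrableOn_sum_expk d S c) (-l)).const_mul _]
    have h3 : ∀ l, ∫ x in cube d, h x * expk d (-l) x = if l ∈ S then c l else 0 :=
      fun l => fCoeff_sum_expk d S c l
    push_cast
    refine Finset.sum_congr rfl fun l hl => ?_
    rw [integral_const_mul, h3, if_pos hl, Complex.conj_mul']
  exact_mod_cast h2

lemma ofReal_mul_sqrt_le_LqNorm (d : ℕ) {K : Finset (Fin d → ℤ)} {m : ℕ} (hK : K.card = 2 * m)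
    (a : ℝ) {s : (Fin d → ℝ) → ℂ} (hs : s ∈ trigPoly d m) :
    ENNReal.ofReal (a * √m) ≤
      LqNorm d ∞ ((fun x => ∑ k ∈ K, (a : ℂ) * expk d k x) - s) := by
  classical
  obtain ⟨Λ, b, hΛ, rfl⟩ := hs
  set g : (Fin d → ℤ) → ℂ := fun k => (if k ∈ K then (a : ℂ) else 0) - if k ∈ Λ then b k else 0
    with hg
  have hfs : ((fun x => ∑ k ∈ K, (a : ℂ) * expk d k x) - fun x => ∑ k ∈ Λ, b k * expk d k x) =
      fun x => ∑ k ∈ K ∪ Λ, g k * expk d k x := by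
    funext x
    simp only [Pi.sub_apply, hg, sub_mul, Finset.sum_sub_distrib, ite_mul, zero_mul,
      Finset.sum_ite_mem]
    rw [Finset.inter_eq_right.mpr Finset.subset_union_left,
      Finset.inter_eq_right.mpr Finset.subset_union_right]
  rw [hfs]
  set h : (Fin d → ℝ) → ℂ := fun x => ∑ k ∈ K ∪ Λ, g k * expk d k x with hh
  by_cases htop : LqNorm d ∞ h = ∞
  · rw [htop]; exact le_top
  set E := (LqNorm d ∞ h).toReal with hE
  have hae : ∀ᵐ x ∂volume.restrict (cube d), ‖h x‖ ≤ E := by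
    filter_upwards [enorm_ae_le_eLpNormEssSup h (volume.restrict (cube d))] with x hx
    rw [hE, LqNorm, eLpNorm_exponent_top, ← toReal_enorm]
    refine ENNReal.toReal_mono ?_ hx
    rwa [LqNorm, eLpNorm_exponent_top] at htop
  have hle : ∫ x in cube d, ‖h x‖ ^ 2 ≤ E ^ 2 := by
    calc ∫ x in cube d, ‖h x‖ ^ 2 ≤ ∫ _ in cube d, E ^ 2 := by
          refine integral_mono_of_nonneg (Filter.Eventually.of_forall fun x => by positivity)
            (integrable_const _) ?_
          filter_upwards [hae] with x hx
          exact pow_le_pow_left₀ (norm_nonneg _) hx 2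
      _ = E ^ 2 := by simp
  rw [hh, integral_norm_sq_sum_expk] at hle
  have hcard : (m : ℝ) ≤ ((K \ Λ).card : ℝ) := by
    have := Finset.le_card_sdiff Λ K
    exact_mod_cast (by omega : m ≤ (K \ Λ).card)
  have hlow : a ^ 2 * m ≤ ∑ k ∈ K ∪ Λ, ‖g k‖ ^ 2 := by
    calc a ^ 2 * m ≤ ∑ k ∈ K \ Λ, ‖g k‖ ^ 2 := by
          rw [Finset.sum_congr rfl (g := fun _ => a ^ 2), Finset.sum_const, nsmul_eq_mul, mul_comm]
          · gcongr
          · intro k hk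
            rw [Finset.mem_sdiff] at hk
            simp [hg, hk.1, hk.2]
      _ ≤ _ := Finset.sum_le_sum_of_subset_of_nonneg
          (Finset.sdiff_subset.trans Finset.subset_union_left) fun _ _ _ => by positivity
  refine ENNReal.ofReal_le_of_le_toReal ?_
  refine le_of_sq_le_sq ?_ ENNReal.toReal_nonneg
  rw [mul_pow, Real.sq_sqrt (Nat.cast_nonneg m)]
  exact hlow.trans hle

lemma wienerNorm_sum_expk_le_one (d : ℕ) {r : ℝ} (hr : 0 ≤ r) {θ : ℝ≥0∞} (hθ : 0 < θ) {W : ℝ}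
    (hW : 0 < W) {K : Finset (Fin d → ℤ)} (hK : ∀ k ∈ K, wt d k ≤ W) :
    wienerNorm d r θ (fun x => ∑ k ∈ K,
      ((W ^ (-r) * (K.card : ℝ) ^ (-(1 / θ.toReal)) : ℝ) : ℂ) * expk d k x) ≤ 1 := by
  set a : ℝ := W ^ (-r) * (K.card : ℝ) ^ (-(1 / θ.toReal)) with ha
  have ha0 : 0 ≤ a := by positivity
  have hbase : ∀ k ∈ K, wt d k ^ r * a ≤ (K.card : ℝ) ^ (-(1 / θ.toReal)) := fun k hk => by
    have h1 : wt d k ^ r ≤ W ^ r := Real.rpow_le_rpow (wt_pos d k).le (hK k hk) hr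
    have h2 : W ^ r * W ^ (-r) = 1 := by
      rw [← Real.rpow_add hW, add_neg_cancel, Real.rpow_zero]
    calc wt d k ^ r * a ≤ W ^ r * a := by gcongr
      _ = _ := by rw [ha, ← mul_assoc, h2, one_mul]
  have hcoef : ∀ k, fCoeff d (fun x => ∑ k ∈ K, (a : ℂ) * expk d k x) k =
      if k ∈ K then (a : ℂ) else 0 := fCoeff_sum_expk d K fun _ => (a : ℂ)
  have hterm : ∀ k ∈ K, ENNReal.ofReal (wt d k ^ r) *
      (‖fCoeff d (fun x => ∑ k ∈ K, (a : ℂ) * expk d k x) k‖₊ : ℝ≥0∞) ≤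
        ENNReal.ofReal ((K.card : ℝ) ^ (-(1 / θ.toReal))) := fun k hk => by
    rw [hcoef, if_pos hk, ← enorm_eq_nnnorm, ← ofReal_norm,
      ← ENNReal.ofReal_mul (Real.rpow_nonneg (wt_pos d k).le r), Complex.norm_real,
      Real.norm_of_nonneg ha0]
    exact ENNReal.ofReal_le_ofReal (hbase k hk)
  have hterm0 : ∀ k ∉ K, ENNReal.ofReal (wt d k ^ r) *
      (‖fCoeff d (fun x => ∑ k ∈ K, (a : ℂ) * expk d k x) k‖₊ : ℝ≥0∞) = 0 := fun k hk => by
    rw [hcoef, if_neg hk]; simp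
  rw [wienerNorm]
  split_ifs with htop
  · refine iSup_le fun k => ?_
    by_cases hk : k ∈ K
    · refine (hterm k hk).trans ?_
      simp [htop]
    · rw [hterm0 k hk]; exact zero_le_one
  · have hp : 0 < θ.toReal := ENNReal.toReal_pos hθ.ne' htop
    refine ENNReal.rpow_le_one ?_ (by positivity)
    rw [tsum_eq_sum (s := K) fun k hk => by rw [hterm0 k hk, ENNReal.zero_rpow_of_pos hp]]
    rcases K.eq_empty_or_nonempty with rfl | hne
    · simp
    have hc : (0 : ℝ) < K.card := by exact_mod_cast hne.card_pos
    calc _ ≤ ∑ k ∈ K, (ENNReal.ofReal ((K.card : ℝ) ^ (-(1 / θ.toReal)))) ^ θ.toReal :=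
          Finset.sum_le_sum fun k hk => ENNReal.rpow_le_rpow (hterm k hk) hp.le
      _ = 1 := by
          rw [Finset.sum_const, ENNReal.ofReal_rpow_of_nonneg (by positivity) hp.le,
            ← Real.rpow_mul hc.le, neg_mul, one_div_mul_cancel hp.ne', nsmul_eq_mul,
            ← ENNReal.ofReal_natCast, ← ENNReal.ofReal_mul hc.le, Real.rpow_neg_one,
            mul_inv_cancel₀ hc.ne', ENNReal.ofReal_one]

lemma ofReal_le_sigmaClass (d : ℕ) {r : ℝ} (hr : 0 ≤ r) {θ : ℝ≥0∞} (hθ : 0 < θ) {W : ℝ}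
    (hW : 0 < W) {m : ℕ} (hm : 2 * m ≤ (cross d W).card) :
    ENNReal.ofReal (W ^ (-r) * ((2 * m : ℕ) : ℝ) ^ (-(1 / θ.toReal)) * √m) ≤
      sigmaClass d m (wienerNorm d r θ) (LqNorm d ∞) := by
  obtain ⟨K, hKW, hKc⟩ := Finset.exists_subset_card_eq hm
  have hK : ∀ k ∈ K, wt d k ≤ W := fun k hk => mem_cross.mp (hKW hk)
  have h1 := wienerNorm_sum_expk_le_one d hr hθ hW hK
  rw [hKc] at h1
  refine le_trans ?_ (le_iSup₂ (f := fun f _ => sigmaF d m (LqNorm d ∞) f) _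
    (⟨integrableOn_sum_expk d K _, h1⟩ : _ ∈ unitBall d (wienerNorm d r θ)))
  exact le_iInf₂ fun s hs => ofReal_mul_sqrt_le_LqNorm d hKc _ hs

lemma logStar_le_two_mul_log {m : ℕ} (hm : 2 ≤ m) : logStar m ≤ 2 * Real.log m := by
  have h2 : (1 / 2 : ℝ) ≤ Real.log 2 := by linarith [Real.log_two_gt_d9]
  have hm' : Real.log 2 ≤ Real.log m := Real.log_le_log (by norm_num) (by exact_mod_cast hm)
  refine max_le ?_ (by linarith)
  rw [Real.logb, div_le_iff₀ (by linarith)]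
  nlinarith

lemma log_le_logStar (m : ℕ) : Real.log m ≤ logStar m := by
  refine le_trans ?_ (le_max_left _ _)
  have h0 : 0 ≤ Real.log (m : ℝ) := Real.log_natCast_nonneg m
  rw [Real.logb, le_div_iff₀ (Real.log_pos (by norm_num))]
  nlinarith [Real.log_two_lt_d9]

lemma eventually_log_pow_le_sqrt (d : ℕ) {A : ℝ} (hA : 0 < A) :
    ∀ᶠ x : ℝ in Filter.atTop, Real.log x ^ d ≤ A * √x := by
  have h := (isLittleO_log_rpow_rpow_atTop (s := 1 / 2) (d : ℝ) (by norm_num)).bound hA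
  filter_upwards [h, Filter.eventually_ge_atTop 1] with x hx hx1
  rw [Real.rpow_natCast, ← Real.sqrt_eq_rpow, Real.norm_of_nonneg (Real.sqrt_nonneg x)] at hx
  exact (le_abs_self _).trans hx

theorem sigmaClass_lower_bound (d : ℕ) {r : ℝ} (hr : 0 ≤ r) {θ : ℝ≥0∞} (hθ : 0 < θ) :
    ∃ c : ℝ, 0 < c ∧ ∀ᶠ m : ℕ in Filter.atTop,
      ENNReal.ofReal (c * ((m : ℝ) ^ (-(r + 1 / θ.toReal - 1 / 2)) * logStar m ^ ((d : ℝ) * r)))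
        ≤ sigmaClass (d + 1) m (wienerNorm (d + 1) r θ) (LqNorm (d + 1) ∞) := by
  obtain ⟨c, hc, hcard⟩ := le_card_cross d
  set t := 1 / θ.toReal with ht
  set A : ℝ := 2 ^ (d + 1) / c with hA
  have hA0 : 0 < A := by positivity
  refine ⟨A ^ (-r) * 2 ^ (-t) * (1 / 2) ^ ((d : ℝ) * r), by positivity, ?_⟩
  filter_upwards [tendsto_natCast_atTop_atTop.eventually (eventually_log_pow_le_sqrt d hA0),
    Filter.eventually_ge_atTop 2] with m hlog hm
  have hm1 : (2 : ℝ) ≤ m := by exact_mod_cast hm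
  have hm0 : (0 : ℝ) < m := by linarith
  have hl0 : 0 < Real.log m := Real.log_pos (by linarith)
  set W : ℝ := A * (m / Real.log m ^ d) with hW
  have hWs : √m ≤ W := by
    rw [hW, mul_div_assoc', le_div_iff₀ (by positivity)]
    calc √m * Real.log m ^ d ≤ √m * (A * √m) := by gcongr
      _ = A * (√m * √m) := by ring
      _ = A * m := by rw [Real.mul_self_sqrt hm0.le]
  have hW1 : 1 ≤ W := (Real.one_le_sqrt.mpr (by linarith)).trans hWs
  have hlW : Real.log m / 2 ≤ Real.log W := by
    rw [← Real.log_sqrt hm0.le]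
    exact Real.log_le_log (by positivity) hWs
  have hcr : 2 * m ≤ (cross (d + 1) W).card := by
    have : (2 * m : ℝ) ≤ (cross (d + 1) W).card := by
      refine le_trans ?_ (hcard W hW1)
      calc (2 * m : ℝ) = c * W * (Real.log m / 2) ^ d := by
            rw [hW, hA, div_pow, pow_succ]; field_simp
        _ ≤ _ := by gcongr
    exact_mod_cast this
  refine le_trans (ENNReal.ofReal_le_ofReal ?_) (ofReal_le_sigmaClass (d + 1) hr hθ (by linarith) hcr)
  have e1 : W ^ (-r) = A ^ (-r) * (m : ℝ) ^ (-r) * Real.log m ^ ((d : ℝ) * r) := by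
    rw [hW, Real.mul_rpow hA0.le (by positivity), Real.div_rpow hm0.le (by positivity),
      ← Real.rpow_natCast, ← Real.rpow_mul hl0.le, mul_neg, Real.rpow_neg hl0.le, div_inv_eq_mul,
      mul_assoc]
  have e2 : (m : ℝ) ^ (-(r + t - 1 / 2)) = (m : ℝ) ^ (-r) * (m : ℝ) ^ (-t) * √m := by
    rw [Real.sqrt_eq_rpow, ← Real.rpow_add hm0, ← Real.rpow_add hm0]
    congr 1; ring
  have e3 : (((2 * m : ℕ) : ℝ)) ^ (-t) = 2 ^ (-t) * (m : ℝ) ^ (-t) := by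
    push_cast
    rw [Real.mul_rpow (by norm_num) hm0.le]
  have e4 : (1 / 2 : ℝ) ^ ((d : ℝ) * r) * logStar m ^ ((d : ℝ) * r) ≤
      Real.log m ^ ((d : ℝ) * r) := by
    have hs1 : 1 ≤ logStar m := le_max_right _ _
    rw [← Real.mul_rpow (by norm_num) (by linarith)]
    refine Real.rpow_le_rpow (by linarith) ?_ (by positivity)
    linarith [logStar_le_two_mul_log hm]
  rw [e1, e2, e3]
  calc _ = A ^ (-r) * 2 ^ (-t) * ((m : ℝ) ^ (-r) * (m : ℝ) ^ (-t) * √m) *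
        ((1 / 2 : ℝ) ^ ((d : ℝ) * r) * logStar m ^ ((d : ℝ) * r)) := by ring
    _ ≤ A ^ (-r) * 2 ^ (-t) * ((m : ℝ) ^ (-r) * (m : ℝ) ^ (-t) * √m) *
        Real.log m ^ ((d : ℝ) * r) := by gcongr
    _ = _ := by ring

/-- The weighted `ℓ_θ` (quasi-)norm bound `≤ 1` for a family of extended nonnegative reals. -/
def CoeffBound (d : ℕ) (r : ℝ) (θ : ℝ≥0∞) (b : (Fin d → ℤ) → ℝ≥0∞) : Prop :=
  if θ = ∞ then ∀ k, ENNReal.ofReal (wt d k ^ r) * b k ≤ 1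
  else ∑' k, (ENNReal.ofReal (wt d k ^ r) * b k) ^ θ.toReal ≤ 1

lemma coeffBound_of_wienerNorm_le_one {d : ℕ} {r : ℝ} {θ : ℝ≥0∞} (hθ : 0 < θ)
    {f : (Fin d → ℝ) → ℂ} (hf : wienerNorm d r θ f ≤ 1) :
    CoeffBound d r θ fun k => ‖fCoeff d f k‖ₑ := by
  rw [wienerNorm] at hf
  rw [CoeffBound]
  split_ifs at hf ⊢ with htop
  · exact fun k => (le_iSup (fun k => ENNReal.ofReal (wt d k ^ r) *
      (‖fCoeff d f k‖₊ : ℝ≥0∞)) k).trans hf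
  · have hp : 0 < θ.toReal := ENNReal.toReal_pos hθ.ne' htop
    have h := ENNReal.rpow_le_rpow hf hp.le
    rwa [← ENNReal.rpow_mul, one_div_mul_cancel hp.ne', ENNReal.rpow_one, ENNReal.one_rpow] at h

lemma ofReal_wt_rpow_neg_mul (d : ℕ) (r : ℝ) (k : Fin d → ℤ) (x : ℝ≥0∞) :
    ENNReal.ofReal (wt d k ^ (-r)) * (ENNReal.ofReal (wt d k ^ r) * x) = x := by
  have h := wt_pos d k
  rw [← mul_assoc, ← ENNReal.ofReal_mul (by positivity), ← Real.rpow_add h, neg_add_cancel,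
    Real.rpow_zero, ENNReal.ofReal_one, one_mul]

/-- Hölder estimate for the tail outside a hyperbolic cross when `θ > 1`. -/
lemma exists_tail_le_of_one_lt (d : ℕ) {r : ℝ} {θ : ℝ≥0∞} (hθ : 1 < θ)
    (hr : 1 - 1 / θ.toReal < r) : ∃ C : ℝ, 0 < C ∧
      ∀ b, CoeffBound (d + 1) r θ b → ∀ W : ℝ, 1 ≤ W →
        ∑' k, (if W < wt (d + 1) k then b k else 0) ≤ ENNReal.ofReal (C *
          (W ^ (1 - 1 / θ.toReal - r) * (1 + Real.log W) ^ ((d : ℝ) * (1 - 1 / θ.toReal)))) := by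
  by_cases htop : θ = ∞
  · have hr1 : 1 < r := by simpa [htop] using hr
    obtain ⟨C, hC, h⟩ := tsum_wt_rpow_neg_le d hr1
    refine ⟨C, hC, fun b hb W hW => ?_⟩
    rw [CoeffBound, if_pos htop] at hb
    simp only [htop, ENNReal.toReal_top, _root_.div_zero, sub_zero, mul_one, Real.rpow_natCast]
    refine le_trans (ENNReal.tsum_le_tsum fun k => ?_) (h W hW)
    split_ifs
    · rw [← ofReal_wt_rpow_neg_mul (d + 1) r k (b k)]
      exact mul_le_of_le_one_right' (hb k)
    · exact le_rfl
  · have hp1 : 1 < θ.toReal := by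
      simpa using (ENNReal.toReal_lt_toReal ENNReal.one_ne_top htop).mpr hθ
    set p := θ.toReal with hp
    have hpq := Real.HolderConjugate.conjExponent hp1
    set q := p.conjExponent with hq
    have hq0 : 0 < q := hpq.symm.pos
    have hu : 1 - 1 / p = 1 / q := by
      rw [one_div, one_div, ← hpq.one_sub_inv]
    rw [hu] at hr ⊢
    have hs : 1 < r * q := by rwa [div_lt_iff₀ hq0] at hr
    obtain ⟨C, hC, h⟩ := tsum_wt_rpow_neg_le d hs
    refine ⟨C ^ (1 / q), by positivity, fun b hb W hW => ?_⟩
    rw [CoeffBound, if_neg htop] at hb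
    have hlog : 0 ≤ Real.log W := Real.log_nonneg hW
    set F : (Fin (d + 1) → ℤ) → ℝ≥0∞ := fun k => ENNReal.ofReal (wt (d + 1) k ^ r) * b k with hF
    set G : (Fin (d + 1) → ℤ) → ℝ≥0∞ := fun k =>
      if W < wt (d + 1) k then ENNReal.ofReal (wt (d + 1) k ^ (-r)) else 0 with hG
    have hol := ENNReal.lintegral_mul_le_Lp_mul_Lq Measure.count hpq
      (f := F) (g := G) (measurable_of_countable _).aemeasurable
      (measurable_of_countable _).aemeasurable
    simp only [lintegral_count] at hol
    have hl : ∀ k, (if W < wt (d + 1) k then b k else 0) = (F * G) k := fun k => by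
      simp only [Pi.mul_apply, hG, hF]
      split_ifs
      · rw [mul_comm, ofReal_wt_rpow_neg_mul]
      · rw [mul_zero]
    have hGq : ∀ k, G k ^ q =
        if W < wt (d + 1) k then ENNReal.ofReal (wt (d + 1) k ^ (-(r * q))) else 0 := fun k => by
      simp only [hG]
      split_ifs
      · have := wt_pos (d + 1) k
        rw [ENNReal.ofReal_rpow_of_nonneg (by positivity) hq0.le, ← Real.rpow_mul this.le, neg_mul]
      · exact ENNReal.zero_rpow_of_pos hq0
    calc ∑' k, (if W < wt (d + 1) k then b k else 0) = ∑' k, (F * G) k := by simp_rw [hl]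
      _ ≤ _ := hol
      _ ≤ 1 * ENNReal.ofReal (C * (W ^ (1 - r * q) * (1 + Real.log W) ^ d)) ^ (1 / q) := by
          gcongr
          · exact ENNReal.rpow_le_one hb (by positivity)
          · simp_rw [hGq]
            exact h W hW
      _ = _ := by
          have hW0 : 0 < W := by linarith
          rw [one_mul, ENNReal.ofReal_rpow_of_nonneg (by positivity) (by positivity),
            Real.mul_rpow hC.le (by positivity), Real.mul_rpow (by positivity) (by positivity),
            ← Real.rpow_mul hW0.le, ← Real.rpow_natCast, ← Real.rpow_mul (by positivity)]
          congr 4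
          · field_simp

lemma one_add_log_rpow_le {D ε : ℝ} (hD : 0 ≤ D) (hε : 0 < ε) : ∃ C : ℝ, 0 < C ∧
    ∀ W : ℝ, 1 ≤ W → (1 + Real.log W) ^ D ≤ C * W ^ ε := by
  set η := ε / (D + 1) with hη
  have hη0 : 0 < η := by positivity
  refine ⟨(1 + 1 / η) ^ D, by positivity, fun W hW => ?_⟩
  have hW0 : 0 < W := by linarith
  have hlog : 0 ≤ Real.log W := Real.log_nonneg hW
  have h1 : 1 ≤ W ^ η := Real.one_le_rpow hW hη0.le
  have h2 : 1 + Real.log W ≤ (1 + 1 / η) * W ^ η := by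
    have := Real.log_le_rpow_div hW0.le hη0
    calc 1 + Real.log W ≤ W ^ η + W ^ η / η := by linarith
      _ = _ := by ring
  calc (1 + Real.log W) ^ D ≤ ((1 + 1 / η) * W ^ η) ^ D := by gcongr
    _ = (1 + 1 / η) ^ D * W ^ (η * D) := by
        rw [Real.mul_rpow (by positivity) (by positivity), ← Real.rpow_mul hW0.le]
    _ ≤ (1 + 1 / η) ^ D * W ^ ε := by
        gcongr
        · rw [hη, div_mul_eq_mul_div, div_le_iff₀ (by linarith)]
          nlinarith

/-- Decay of the tail, and a set of at most `2p` frequencies carrying the bulk of the coefficients. -/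
lemma exists_coeff_split (d : ℕ) {r : ℝ} {θ : ℝ≥0∞} (hθ : 0 < θ)
    (hr : max (1 - 1 / θ.toReal) 0 < r) : ∃ C δ : ℝ, 0 < C ∧ 0 < δ ∧
      ∀ b, CoeffBound (d + 1) r θ b →
        (∀ V : ℝ, 1 ≤ V →
          ∑' k, (if V < wt (d + 1) k then b k else 0) ≤ ENNReal.ofReal (C * V ^ (-δ))) ∧
        ∀ (p : ℕ) (W : ℝ), 1 ≤ p → 1 ≤ W → 2 ^ (d + 1) * W * (1 + Real.log W) ^ d ≤ p →
          ∃ Λ : Finset (Fin (d + 1) → ℤ), Λ.card ≤ 2 * p ∧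
            ∑' k, (if k ∉ Λ then b k else 0) ≤
              ENNReal.ofReal (C * ((p : ℝ) ^ (1 - 1 / θ.toReal) * W ^ (-r))) := by
  have hr0 : 0 < r := (le_max_right _ _).trans_lt hr
  have hr1 : 1 - 1 / θ.toReal < r := (le_max_left _ _).trans_lt hr
  have hcross : ∀ (p : ℕ) (W : ℝ), 1 ≤ W → 2 ^ (d + 1) * W * (1 + Real.log W) ^ d ≤ p →
      (cross (d + 1) W).card ≤ p := fun p W hW h => by
    exact_mod_cast (card_cross_le d W hW).trans h
  rcases lt_or_ge 1 θ with h1 | h1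
  · obtain ⟨C, hC, h⟩ := exists_tail_le_of_one_lt d h1 hr1
    set u := 1 - 1 / θ.toReal with hu
    have hu0 : 0 ≤ u := by
      by_cases htop : θ = ∞
      · simp [hu, htop]
      · have : 1 < θ.toReal := by
          simpa using (ENNReal.toReal_lt_toReal ENNReal.one_ne_top htop).mpr h1
        rw [hu, sub_nonneg, div_le_one (by linarith)]
        exact this.le
    obtain ⟨C', hC', hlogle⟩ := one_add_log_rpow_le (D := (d : ℝ) * u) (by positivity)
      (show 0 < (r - u) / 2 by linarith)
    refine ⟨max C (C * C'), (r - u) / 2, by positivity, by linarith, fun b hb => ⟨?_, ?_⟩⟩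
    · intro V hV
      have hV0 : 0 < V := by linarith
      refine (h b hb V hV).trans (ENNReal.ofReal_le_ofReal ?_)
      calc C * (V ^ (u - r) * (1 + Real.log V) ^ ((d : ℝ) * u))
          ≤ C * (V ^ (u - r) * (C' * V ^ ((r - u) / 2))) := by gcongr; exact hlogle V hV
        _ = C * C' * (V ^ (u - r) * V ^ ((r - u) / 2)) := by ring
        _ = C * C' * V ^ (-((r - u) / 2)) := by
            rw [← Real.rpow_add hV0]; congr 2; ring
        _ ≤ _ := by gcongr; exact le_max_right _ _
    · intro p W hp hW hpW
      have hW0 : 0 < W := by linarith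
      have hlog : 0 ≤ Real.log W := Real.log_nonneg hW
      refine ⟨cross (d + 1) W, (hcross p W hW hpW).trans (by omega), ?_⟩
      simp_rw [mem_cross, not_le]
      refine (h b hb W hW).trans (ENNReal.ofReal_le_ofReal ?_)
      have h2 : W * (1 + Real.log W) ^ d ≤ p := by
        refine le_trans ?_ hpW
        rw [mul_assoc]
        exact le_mul_of_one_le_left (by positivity) (one_le_pow₀ (by norm_num))
      have h3 : W ^ (u - r) * (1 + Real.log W) ^ ((d : ℝ) * u) =
          (W * (1 + Real.log W) ^ d) ^ u * W ^ (-r) := by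
        rw [Real.mul_rpow hW0.le (by positivity), ← Real.rpow_natCast,
          ← Real.rpow_mul (by positivity), sub_eq_add_neg, Real.rpow_add hW0]
        ring
      rw [h3]
      gcongr
      exact le_max_left _ _
  · have htop : θ ≠ ∞ := ne_top_of_le_ne_top ENNReal.one_ne_top h1
    have hp0 : 0 < θ.toReal := ENNReal.toReal_pos hθ.ne' htop
    have hp1 : θ.toReal ≤ 1 := by
      simpa using (ENNReal.toReal_le_toReal htop ENNReal.one_ne_top).mpr h1
    set ϑ := θ.toReal with hϑ
    refine ⟨1, r, one_pos, hr0, fun b hb => ?_⟩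
    rw [CoeffBound, if_neg htop] at hb
    set a : (Fin (d + 1) → ℤ) → ℝ≥0∞ := fun k => ENNReal.ofReal (wt (d + 1) k ^ r) * b k with ha
    have ha1 : ∀ k, a k ^ ϑ ≤ 1 := fun k => (ENNReal.le_tsum k).trans hb
    have hab : ∀ (W : ℝ) k, 1 ≤ W → W < wt (d + 1) k → b k ≤ ENNReal.ofReal (W ^ (-r)) * a k := by
      intro W k hW hk
      rw [← ofReal_wt_rpow_neg_mul (d + 1) r k (b k)]
      gcongr ENNReal.ofReal ?_ * _
      exact Real.rpow_le_rpow_of_nonpos (by linarith) hk.le (by linarith)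
    have hsplit : ∀ k, a k = (a k ^ ϑ) ^ (1 / ϑ - 1) * a k ^ ϑ := fun k => by
      have h0 : 0 ≤ 1 / ϑ - 1 := by rw [sub_nonneg, le_div_iff₀ hp0]; linarith
      conv_rhs => rw [← ENNReal.rpow_one (a k ^ ϑ)]
      rw [ENNReal.rpow_one, ← ENNReal.rpow_mul, ← ENNReal.rpow_add_of_nonneg _ _ (by positivity)
        hp0.le, show ϑ * (1 / ϑ - 1) + ϑ = 1 by field_simp; ring, ENNReal.rpow_one]
    have h0 : 0 ≤ 1 / ϑ - 1 := by rw [sub_nonneg, le_div_iff₀ hp0]; linarith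
    constructor
    · intro V hV
      rw [one_mul]
      calc ∑' k, (if V < wt (d + 1) k then b k else 0)
          ≤ ∑' k, ENNReal.ofReal (V ^ (-r)) * a k ^ ϑ := by
            refine ENNReal.tsum_le_tsum fun k => ?_
            split_ifs with hk
            · refine (hab V k hV hk).trans ?_
              gcongr
              conv_lhs => rw [hsplit k]
              exact mul_le_of_le_one_left' (ENNReal.rpow_le_one (ha1 k) h0)
            · exact zero_le
        _ ≤ ENNReal.ofReal (V ^ (-r)) := by
            rw [ENNReal.tsum_mul_left]
            exact mul_le_of_le_one_right' hb
    · intro p W hp hW hpW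
      classical
      have hpR : (0 : ℝ) < p := by exact_mod_cast hp
      have hpE : (p : ℝ≥0∞)⁻¹ ≠ 0 := ENNReal.inv_ne_zero.mpr (ENNReal.natCast_ne_top p)
      obtain ⟨hfin, hcard⟩ := ENNReal.finset_card_const_le_le_of_tsum_le ENNReal.one_ne_top hb hpE
      rw [one_div, inv_inv] at hcard
      have hcard' : hfin.toFinset.card ≤ p := by exact_mod_cast hcard
      refine ⟨cross (d + 1) W ∪ hfin.toFinset, (Finset.card_union_le _ _).trans
        (by linarith [hcross p W hW hpW]), ?_⟩
      calc _ ≤ ∑' k, ENNReal.ofReal (W ^ (-r)) * (ENNReal.ofReal ((p : ℝ) ^ (1 - 1 / ϑ)) *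
              a k ^ ϑ) := by
            refine ENNReal.tsum_le_tsum fun k => ?_
            split_ifs with hk
            · exact zero_le
            · simp only [Finset.mem_union, mem_cross, Set.Finite.mem_toFinset, Set.mem_ofPred_eq,
                not_or, not_le] at hk
              refine (hab W k hW hk.1).trans ?_
              gcongr
              conv_lhs => rw [hsplit k]
              gcongr
              refine (ENNReal.rpow_le_rpow hk.2.le h0).trans_eq ?_
              rw [← ENNReal.ofReal_natCast, ← ENNReal.ofReal_inv_of_pos hpR,
                ENNReal.ofReal_rpow_of_pos (by positivity), Real.inv_rpow hpR.le,
                ← Real.rpow_neg hpR.le, neg_sub]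
        _ ≤ ENNReal.ofReal (W ^ (-r)) * ENNReal.ofReal ((p : ℝ) ^ (1 - 1 / ϑ)) := by
            rw [ENNReal.tsum_mul_left, ENNReal.tsum_mul_left]
            gcongr
            exact mul_le_of_le_one_right' hb
        _ = _ := by
            rw [← ENNReal.ofReal_mul (by positivity), one_mul, mul_comm]

lemma trigPoly_mono (d : ℕ) {m n : ℕ} (h : m ≤ n) : trigPoly d m ⊆ trigPoly d n := by
  rintro _ ⟨Λ, a, hΛ, rfl⟩
  exact ⟨Λ, a, hΛ.trans h, rfl⟩

lemma add_mem_trigPoly (d : ℕ) {m n : ℕ} {s t : (Fin d → ℝ) → ℂ} (hs : s ∈ trigPoly d m)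
    (ht : t ∈ trigPoly d n) : (fun x => s x + t x) ∈ trigPoly d (m + n) := by
  classical
  obtain ⟨Λ, a, hΛ, rfl⟩ := hs
  obtain ⟨Γ, b, hΓ, rfl⟩ := ht
  refine ⟨Λ ∪ Γ, fun k => (if k ∈ Λ then a k else 0) + if k ∈ Γ then b k else 0,
    (Finset.card_union_le _ _).trans (by omega), ?_⟩
  funext x
  simp only [add_mul, Finset.sum_add_distrib, ite_mul, zero_mul, Finset.sum_ite_mem]
  rw [Finset.inter_eq_right.mpr Finset.subset_union_left,
    Finset.inter_eq_right.mpr Finset.subset_union_right]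

lemma continuous_of_mem_trigPoly {d m : ℕ} {s : (Fin d → ℝ) → ℂ} (hs : s ∈ trigPoly d m) :
    Continuous s := by
  obtain ⟨Λ, a, -, rfl⟩ := hs
  exact continuous_finsetSum _ fun k _ => continuous_const.mul (continuous_expk d k)

lemma tsum_ne_top_of_tail (d : ℕ) {b : (Fin d → ℤ) → ℝ≥0∞} (hb : ∀ k, b k ≠ ∞) {V : ℝ}
    (h : ∑' k, (if V < wt d k then b k else 0) ≠ ∞) : ∑' k, b k ≠ ∞ := by
  classical
  have h1 : ∀ k, b k = (if V < wt d k then b k else 0) + if k ∈ cross d V then b k else 0 :=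
    fun k => by
      by_cases hk : V < wt d k
      · simp [hk, mem_cross, not_le.mpr hk]
      · simp [hk, mem_cross, not_lt.mp hk]
  rw [tsum_congr h1, ENNReal.tsum_add,
    tsum_eq_sum (s := cross d V) (f := fun k => if k ∈ cross d V then b k else 0)
      fun k hk => if_neg hk]
  refine ENNReal.add_ne_top.mpr ⟨h, ENNReal.sum_ne_top.mpr fun k hk => ?_⟩
  rw [if_pos hk]
  exact hb k

/-- Keep the frequencies in `Λ` exactly, sparsify those in the hyperbolic cross of size `V`, and
drop the rest. -/
lemma sigmaF_le_of_split (d : ℕ) {f : (Fin d → ℝ) → ℂ} (hf : IntegrableOn f (cube d))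
    {Λ : Finset (Fin d → ℤ)} {p L : ℕ} (hp : 0 < p) (hL : 0 < L) (hΛ : Λ.card ≤ 2 * p)
    {V T A : ℝ} (hV : 0 ≤ V) (hT0 : 0 ≤ T) (hA0 : 0 ≤ A)
    (hT : ∑' k, (if V < wt d k then ‖fCoeff d f k‖ₑ else 0) ≤ ENNReal.ofReal T)
    (hA : ∑' k, (if k ∉ Λ then ‖fCoeff d f k‖ₑ else 0) ≤ ENNReal.ofReal A) :
    sigmaF d (3 * p) (LqNorm d ∞) f ≤ ENNReal.ofReal
      (T + A * (4 * Real.pi * d * V / L + 6 * √(Real.log (4 * L ^ d) / p))) := by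
  classical
  set E : ℝ := 4 * Real.pi * d * V / L + 6 * √(Real.log (4 * L ^ d) / p) with hE
  have hE0 : 0 ≤ E := by positivity
  set c := fCoeff d f with hc
  set Γ := cross d V \ Λ with hΓ
  obtain ⟨s, hs, hsle⟩ := exists_sparse_approx Γ c (M := V) (fun k hk i => by
    have h1 := mem_cross.mp (Finset.mem_sdiff.mp hk).1
    have h2 := one_add_abs_le_wt d k i
    linarith) hV hp hL
  have hsumΓ : ∑ k ∈ Γ, ‖c k‖ ≤ A := by
    rw [← ENNReal.ofReal_le_ofReal_iff hA0, ENNReal.ofReal_sum_of_nonneg fun _ _ => norm_nonneg _]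
    refine le_trans ?_ hA
    refine le_trans (Finset.sum_le_sum fun k hk => ?_) (ENNReal.sum_le_tsum Γ)
    rw [if_pos (Finset.mem_sdiff.mp hk).2, ofReal_norm]
  have hfin : ∑' k, ‖c k‖ₑ ≠ ∞ :=
    tsum_ne_top_of_tail d (fun k => enorm_ne_top) (ne_top_of_le_ne_top ENNReal.ofReal_ne_top hT)
  have hhead := LqNorm_sub_sum_le hf hfin (Λ ∪ Γ)
  have htail : ∑' k : {k // k ∉ Λ ∪ Γ}, ‖fCoeff d f k‖ₑ ≤ ENNReal.ofReal T := by
    refine le_trans ?_ hT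
    rw [show (∑' k : {k // k ∉ Λ ∪ Γ}, ‖fCoeff d f k‖ₑ) = _ from
      tsum_subtype {k | k ∉ Λ ∪ Γ} fun k => ‖fCoeff d f k‖ₑ]
    refine ENNReal.tsum_le_tsum fun k => Set.indicator_apply_le' (fun hk => ?_) fun _ => zero_le
    have hk' : k ∉ Λ ∧ k ∉ Γ := by simpa [not_or] using hk
    have : V < wt d k := by
      by_contra hcon
      exact hk'.2 (Finset.mem_sdiff.mpr ⟨mem_cross.mpr (not_lt.mp hcon), hk'.1⟩)
    rw [if_pos this]
  have hΛmem : (fun x => ∑ k ∈ Λ, c k * expk d k x) ∈ trigPoly d (2 * p) := ⟨Λ, c, hΛ, rfl⟩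
  have hmem := add_mem_trigPoly d hΛmem hs
  rw [show 2 * p + p = 3 * p by ring] at hmem
  refine (iInf₂_le _ hmem).trans ?_
  have hdec : (f - fun x => (∑ k ∈ Λ, c k * expk d k x) + s x) =
      (fun x => f x - ∑ k ∈ Λ ∪ Γ, c k * expk d k x) +
        fun x => ∑ k ∈ Γ, c k * expk d k x - s x := by
    funext x
    simp only [Pi.sub_apply, Pi.add_apply]
    rw [Finset.sum_union Finset.disjoint_sdiff]
    ring
  have hcont : ∀ S : Finset (Fin d → ℤ), Continuous fun x => ∑ k ∈ S, c k * expk d k x :=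
    fun S => continuous_finsetSum _ fun k _ => continuous_const.mul (continuous_expk d k)
  rw [hdec, LqNorm]
  refine (eLpNorm_add_le (hf.aestronglyMeasurable.sub (hcont _).aestronglyMeasurable)
    ((hcont _).sub (continuous_of_mem_trigPoly hs)).aestronglyMeasurable le_top).trans ?_
  rw [ENNReal.ofReal_add hT0 (by positivity)]
  refine add_le_add (hhead.trans htail) ?_
  rw [eLpNorm_exponent_top]
  refine eLpNormEssSup_le_of_ae_enorm_bound ?_
  filter_upwards [ae_restrict_mem (measurableSet_cube d)] with x hx
  rw [← ofReal_norm]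
  exact ENNReal.ofReal_le_ofReal ((hsle x hx).trans (by gcongr))

lemma sparse_error_le (D B : ℕ) {p : ℕ} (hp : 3 ≤ p) :
    4 * Real.pi * D * (p : ℝ) ^ B / ((p ^ (B + 1) : ℕ) : ℝ) +
        6 * √(Real.log (4 * ((p ^ (B + 1) : ℕ) : ℝ) ^ D) / p) ≤
      (4 * Real.pi * D + 6 * √(2 + (B + 1) * D)) * √(Real.log p / p) := by
  have hp3 : (3 : ℝ) ≤ p := by exact_mod_cast hp
  have hp0 : (0 : ℝ) < p := by linarith
  have hl1 : 1 ≤ Real.log p := by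
    rw [Real.le_log_iff_exp_le hp0]
    linarith [Real.exp_one_lt_d9]
  have h1 : 1 / (p : ℝ) ≤ √(Real.log p / p) := by
    refine Real.le_sqrt_of_sq_le ?_
    rw [div_pow, one_pow, sq, div_le_div_iff₀ (by positivity) hp0]
    nlinarith
  have h4 : Real.log 4 ≤ 2 := by
    rw [show (4 : ℝ) = 2 ^ 2 by norm_num, Real.log_pow]
    push_cast
    linarith [Real.log_two_lt_d9]
  have h2 : Real.log (4 * ((p ^ (B + 1) : ℕ) : ℝ) ^ D) / p ≤
      (2 + (B + 1) * D) * (Real.log p / p) := by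
    rw [mul_div_assoc']
    gcongr
    push_cast
    rw [← pow_mul, Real.log_mul (by norm_num) (by positivity), Real.log_pow]
    push_cast
    nlinarith
  calc _ ≤ 4 * Real.pi * D * √(Real.log p / p) +
        6 * √((2 + (B + 1) * D) * (Real.log p / p)) := by
        refine add_le_add ?_ (by gcongr)
        calc 4 * Real.pi * D * (p : ℝ) ^ B / ((p ^ (B + 1) : ℕ) : ℝ)
            = 4 * Real.pi * D * (1 / p) := by push_cast; rw [pow_succ]; field_simp
          _ ≤ _ := by gcongr
    _ = _ := by
        rw [Real.sqrt_mul (by positivity)]; ring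

theorem sigmaClass_upper_bound (d : ℕ) {r : ℝ} {θ : ℝ≥0∞} (hθ : 0 < θ)
    (hr : max (1 - 1 / θ.toReal) 0 < r) :
    ∃ C : ℝ, 0 < C ∧ ∀ᶠ m : ℕ in Filter.atTop,
      sigmaClass (d + 1) m (wienerNorm (d + 1) r θ) (LqNorm (d + 1) ∞) ≤
        ENNReal.ofReal (C * ((m : ℝ) ^ (-(r + 1 / θ.toReal - 1 / 2)) *
          logStar m ^ ((d : ℝ) * r + 1 / 2))) := by
  have hr0 : 0 < r := (le_max_right _ _).trans_lt hr
  have hr1 : 1 - 1 / θ.toReal < r := (le_max_left _ _).trans_lt hr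
  obtain ⟨C, δ, hC, hδ, hsplit⟩ := exists_coeff_split d hθ hr
  set t := 1 / θ.toReal with ht
  set e := r + t - 1 / 2 with he
  have he0 : 0 < e := by rw [he]; linarith
  set B := ⌈e / δ⌉₊ with hB
  have hBe : e ≤ B * δ := by
    rw [← div_le_iff₀ hδ]
    exact Nat.le_ceil _
  set c₁ : ℝ := 1 / (2 ^ (d + 1) * 2 ^ d) with hc₁
  have hc₁0 : 0 < c₁ := by positivity
  have hc₁1 : c₁ ≤ 1 := by
    rw [hc₁, div_le_one (by positivity)]
    exact one_le_mul_of_one_le_of_one_le (one_le_pow₀ (by norm_num)) (one_le_pow₀ (by norm_num))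
  set K : ℝ := 4 * Real.pi * (d + 1 : ℕ) + 6 * √(2 + (B + 1) * (d + 1 : ℕ)) with hK
  have hK0 : 0 ≤ K := by positivity
  refine ⟨(C + C * c₁ ^ (-r) * K) * 6 ^ e, by positivity, ?_⟩
  have hdiv : Filter.Tendsto (fun m : ℕ => m / 3) Filter.atTop Filter.atTop :=
    Nat.tendsto_div_const_atTop (by norm_num)
  filter_upwards [hdiv.eventually
    (tendsto_natCast_atTop_atTop.eventually (eventually_log_pow_le_sqrt d hc₁0)),
    Filter.eventually_ge_atTop 9] with m hlogp hm
  set p := m / 3 with hp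
  have hp3 : 3 ≤ p := by omega
  have hpm : 3 * p ≤ m := by omega
  have hmp : m ≤ 6 * p := by omega
  have hp3' : (3 : ℝ) ≤ p := by exact_mod_cast hp3
  have hp0 : (0 : ℝ) < p := by linarith
  have hm0 : (0 : ℝ) < m := by exact_mod_cast (by omega : 0 < m)
  have hl1 : 1 ≤ Real.log p := by
    rw [Real.le_log_iff_exp_le hp0]
    linarith [Real.exp_one_lt_d9]
  have hl0 : 0 < Real.log p := by linarith
  set W : ℝ := c₁ * (p / Real.log p ^ d) with hW
  have hW1 : 1 ≤ W := by
    rw [hW, mul_div_assoc', one_le_div₀ (by positivity)]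
    refine hlogp.trans ?_
    gcongr
    rw [Real.sqrt_le_left hp0.le]
    nlinarith
  have hWp : W ≤ p := by
    rw [hW]
    calc c₁ * (p / Real.log p ^ d) ≤ 1 * (p / 1) := by
          gcongr
          exact one_le_pow₀ hl1
      _ = p := by ring
  have hlW : 1 + Real.log W ≤ 2 * Real.log p := by
    have := Real.log_le_log (by linarith) hWp
    linarith
  have hpW : 2 ^ (d + 1) * W * (1 + Real.log W) ^ d ≤ p := by
    have : 0 ≤ Real.log W := Real.log_nonneg hW1
    calc 2 ^ (d + 1) * W * (1 + Real.log W) ^ d ≤ 2 ^ (d + 1) * W * (2 * Real.log p) ^ d := by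
          gcongr
      _ = p := by
          rw [hW, hc₁, mul_pow]; field_simp
  refine iSup₂_le fun f hf => ?_
  obtain ⟨htail, hΛ⟩ := hsplit _ (coeffBound_of_wienerNorm_le_one hθ hf.2)
  obtain ⟨Λ, hΛc, hΛ⟩ := hΛ p W (by omega) hW1 hpW
  have hp1 : (1 : ℝ) ≤ p := by linarith
  have hkey := sigmaF_le_of_split (d + 1) hf.1 (p := p) (L := p ^ (B + 1)) (V := (p : ℝ) ^ B)
    (by omega) (by positivity) hΛc (by positivity) (by positivity) (by positivity)
    (htail _ (one_le_pow₀ hp1)) hΛ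
  have hmono : sigmaF (d + 1) m (LqNorm (d + 1) ∞) f ≤
      sigmaF (d + 1) (3 * p) (LqNorm (d + 1) ∞) f :=
    biInf_mono fun s hs => trigPoly_mono (d + 1) hpm hs
  refine hmono.trans (hkey.trans (ENNReal.ofReal_le_ofReal ?_))
  have e1 : W ^ (-r) = c₁ ^ (-r) * (p : ℝ) ^ (-r) * Real.log p ^ ((d : ℝ) * r) := by
    rw [hW, Real.mul_rpow hc₁0.le (by positivity), Real.div_rpow hp0.le (by positivity),
      ← Real.rpow_natCast, ← Real.rpow_mul hl0.le, mul_neg, Real.rpow_neg hl0.le, div_inv_eq_mul,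
      mul_assoc]
  have e2 : (p : ℝ) ^ (-e) = (p : ℝ) ^ (1 - t) * (p : ℝ) ^ (-r) * (p : ℝ) ^ (-(1 / 2) : ℝ) := by
    rw [← Real.rpow_add hp0, ← Real.rpow_add hp0, he]
    congr 1; ring
  have e3 : √(Real.log p / p) = Real.log p ^ (1 / 2 : ℝ) * (p : ℝ) ^ (-(1 / 2) : ℝ) := by
    rw [Real.sqrt_eq_rpow, Real.div_rpow hl0.le hp0.le, Real.rpow_neg hp0.le, div_eq_mul_inv]
  have e4 : ((p : ℝ) ^ B) ^ (-δ) ≤ (p : ℝ) ^ (-e) := by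
    rw [← Real.rpow_natCast, ← Real.rpow_mul hp0.le]
    exact Real.rpow_le_rpow_of_exponent_le hp1 (by linarith)
  have hlogpow : 1 ≤ Real.log p ^ ((d : ℝ) * r + 1 / 2) := Real.one_le_rpow hl1 (by positivity)
  calc _ ≤ C * (p : ℝ) ^ (-e) * Real.log p ^ ((d : ℝ) * r + 1 / 2) +
        C * ((p : ℝ) ^ (1 - t) * W ^ (-r)) * (K * √(Real.log p / p)) := by
        refine add_le_add ?_ ?_
        · refine (mul_le_mul_of_nonneg_left e4 hC.le).trans ?_
          exact le_mul_of_one_le_right (by positivity) hlogpow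
        · gcongr
          exact sparse_error_le (d + 1) B hp3
    _ = (C + C * c₁ ^ (-r) * K) * ((p : ℝ) ^ (-e) * Real.log p ^ ((d : ℝ) * r + 1 / 2)) := by
        rw [e1, e3, e2, Real.rpow_add hl0]; ring
    _ ≤ (C + C * c₁ ^ (-r) * K) * ((6 ^ e * (m : ℝ) ^ (-e)) *
          logStar m ^ ((d : ℝ) * r + 1 / 2)) := by
        gcongr
        · have h6 : (m : ℝ) / 6 ≤ p := by
            rw [div_le_iff₀ (by norm_num)]
            exact_mod_cast (by omega : m ≤ p * 6)
          refine (Real.rpow_le_rpow_of_nonpos (by positivity) h6 (by linarith)).trans_eq ?_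
          rw [Real.div_rpow hm0.le (by norm_num), Real.rpow_neg (by norm_num : (0 : ℝ) ≤ 6),
            div_inv_eq_mul, mul_comm]
        · refine (Real.log_le_log hp0 ?_).trans (log_le_logStar m)
          exact_mod_cast (by omega : p ≤ m)
    _ = _ := by ring

/-- two-sided bounds for `σ_m(S^r_θ A)_{L_∞}` when `d ≥ 2`. -/
theorem statement4 (d : ℕ) (hd : 2 ≤ d) (θ : ℝ≥0∞) (hθ : 0 < θ) (r : ℝ)
    (hr : max (1 - 1/θ.toReal) 0 < r) :
    ∃ c C : ℝ, 0 < c ∧ 0 < C ∧ ∃ m₀ : ℕ, ∀ m : ℕ, m₀ ≤ m →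
      ENNReal.ofReal (c * ((m : ℝ) ^ (-(r + 1/θ.toReal - 1/2)) *
          logStar m ^ (((d : ℝ) - 1) * r)))
        ≤ sigmaClass d m (wienerNorm d r θ) (LqNorm d ∞) ∧
      sigmaClass d m (wienerNorm d r θ) (LqNorm d ∞)
        ≤ ENNReal.ofReal (C * ((m : ℝ) ^ (-(r + 1/θ.toReal - 1/2)) *
            logStar m ^ (((d : ℝ) - 1) * r + 1/2))) := by
  obtain ⟨n, rfl⟩ : ∃ n, d = n + 1 := ⟨d - 1, by omega⟩
  obtain ⟨c, hc, hlow⟩ := sigmaClass_lower_bound n ((le_max_right _ _).trans hr.le) hθ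
  obtain ⟨C, hC, hup⟩ := sigmaClass_upper_bound n hθ hr
  obtain ⟨m₀, h⟩ := Filter.eventually_atTop.mp (hlow.and hup)
  refine ⟨c, C, hc, hC, m₀, fun m hm => ?_⟩
  rw [Nat.cast_add_one, add_sub_cancel_right]
  exact h m hm

end Paper
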